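/- arXiv:2210.12037 — 7 statements merged into one kernel-verified Lean document; each statement's English description precedes it below -/
import Mathlib

section
/- Let l > 0, A_ref ∈ ℝ^{n×n}, B ∈ ℝ^{n×m}, θ ∈ ℝ^{p×m}, and let Ψ : [t0,∞) → ℝ^p, u_nd : [t0,∞) → ℝ^m, θ̂ : [t0,∞) → ℝ^{p×m} be continuous. Suppose e : [t0,∞) → ℝ^n is differentiable with e'(t) = A_ref·e(t) + B·((θ̂(t) − θ)ᵀ·Ψ(t) + u_nd(t)) for all t ≥ t0, and let Ψ̄ : [t0,∞) → ℝ^p, ē : [t0,∞) → ℝ^n, v̄ : [t0,∞) → ℝ^m be the solutions of the filters Ψ̄'(t) = −l·Ψ̄(t) + Ψ(t), ē'(t) = −l·ē(t) + e(t), v̄'(t) = −l·v̄(t) + θ̂(t)ᵀ·Ψ(t) + u_nd(t) with Ψ̄(t0) = 0, ē(t0) = 0, v̄(t0) = 0. Then for all t ≥ t0: e(t) − l·ē(t) = e^{−l(t−t0)}·e(t0) + A_ref·ē(t) − B·θᵀ·Ψ̄(t) + B·v̄(t). -/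
open Matrix

theorem hasDerivAt_mulVec_aux {a b : ℕ} (M : Matrix (Fin a) (Fin b) ℝ)
    {f : ℝ → Fin b → ℝ} {f' : Fin b → ℝ} {t : ℝ} (h : HasDerivAt f f' t) :
    HasDerivAt (fun s => M.mulVec (f s)) (M.mulVec f') t :=
  (LinearMap.toContinuousLinearMap (Matrix.mulVecLin M)).hasFDerivAt.comp_hasDerivAt t h

/-- Filter identity (eq. (A2)): if `ė = A_ref e + B((θ̂ − θ)ᵀ Ψ + u_nd)` and
`Ψ̄, ē, v̄` are the outputs of the first-order filters with gain `l > 0` and zero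
initial conditions at `t0`, then
`e(t) − l ē(t) = e^{−l(t−t0)} e(t0) + A_ref ē(t) − B θᵀ Ψ̄(t) + B v̄(t)`. -/
theorem filter_identity
    (n m p : ℕ) (t0 l : ℝ) (hl : 0 < l)
    (Aref : Matrix (Fin n) (Fin n) ℝ)
    (B : Matrix (Fin n) (Fin m) ℝ)
    (θ : Matrix (Fin p) (Fin m) ℝ)
    (Ψ : ℝ → Fin p → ℝ) (und : ℝ → Fin m → ℝ)
    (θhat : ℝ → Matrix (Fin p) (Fin m) ℝ)
    (hΨc : ContinuousOn Ψ (Set.Ici t0))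
    (hundc : ContinuousOn und (Set.Ici t0))
    (hθhatc : ∀ i j, ContinuousOn (fun t => θhat t i j) (Set.Ici t0))
    (e : ℝ → Fin n → ℝ)
    (he : ∀ t, t0 ≤ t →
      HasDerivAt e (Aref.mulVec (e t) + B.mulVec ((θhat t - θ)ᵀ.mulVec (Ψ t) + und t)) t)
    (Ψbar : ℝ → Fin p → ℝ) (ebar : ℝ → Fin n → ℝ) (vbar : ℝ → Fin m → ℝ)
    (hΨbar : ∀ t, t0 ≤ t → HasDerivAt Ψbar ((-l) • Ψbar t + Ψ t) t)
    (hebar : ∀ t, t0 ≤ t → HasDerivAt ebar ((-l) • ebar t + e t) t)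
    (hvbar : ∀ t, t0 ≤ t →
      HasDerivAt vbar ((-l) • vbar t + ((θhat t)ᵀ.mulVec (Ψ t) + und t)) t)
    (hΨbar0 : Ψbar t0 = 0) (hebar0 : ebar t0 = 0) (hvbar0 : vbar t0 = 0) :
    ∀ t, t0 ≤ t →
      e t - l • ebar t =
        Real.exp (-l * (t - t0)) • e t0 + Aref.mulVec (ebar t)
          - B.mulVec (θᵀ.mulVec (Ψbar t)) + B.mulVec (vbar t) := by
  intro t ht
  let w : ℝ → Fin n → ℝ := fun s => e s - l • ebar s - Aref.mulVec (ebar s)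
    + B.mulVec (θᵀ.mulVec (Ψbar s)) - B.mulVec (vbar s)
  have hw : ∀ s, t0 ≤ s → HasDerivAt w ((-l) • w s) s := by
    intro s hs
    have h := ((((he s hs).sub ((hebar s hs).const_smul l)).sub
      (hasDerivAt_mulVec_aux Aref (hebar s hs))).add
      (hasDerivAt_mulVec_aux B (hasDerivAt_mulVec_aux θᵀ (hΨbar s hs)))).sub
      (hasDerivAt_mulVec_aux B (hvbar s hs))
    refine h.congr_deriv ?_
    simp only [w, Matrix.transpose_sub, Matrix.sub_mulVec, Matrix.mulVec_add, Matrix.mulVec_sub,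
      Matrix.mulVec_smul]
    module
  have hx : ∀ s, HasDerivAt (fun s : ℝ => Real.exp (l * (s - t0)))
      (Real.exp (l * (s - t0)) * l) s := by
    intro s
    have h := (((hasDerivAt_id s).sub_const t0).const_mul l).exp
    simpa using h
  have hg : ∀ s, t0 ≤ s → HasDerivAt (fun s => Real.exp (l * (s - t0)) • w s) 0 s := by
    intro s hs
    refine ((hx s).smul (hw s hs)).congr_deriv ?_
    module
  have hc := constant_of_has_deriv_right_zero (a := t0) (b := t)
    (fun s hs => (hg s hs.1).continuousAt.continuousWithinAt)
    (fun s hs => (hg s hs.1).hasDerivWithinAt) t ⟨ht, le_rfl⟩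
  have hw0 : w t0 = e t0 := by simp [w, hΨbar0, hebar0, hvbar0]
  simp only [sub_self, mul_zero, Real.exp_zero, one_smul, hw0] at hc
  rw [← hc, smul_smul, ← Real.exp_add]
  have h0 : -l * (t - t0) + l * (t - t0) = 0 := by ring
  rw [h0, Real.exp_zero, one_smul]
  simp only [w]
  abel
end

section
/- Let φ ∈ ℝ^{p×p} be symmetric positive semidefinite with eigendecomposition φ = V·diag(λ_1, …, λ_p)·Vᵀ (V orthogonal), λ_i > 0 for 1 ≤ i ≤ r, λ_i = 0 for r < i ≤ p, assume λ_i ≥ ε̄ > 0 for i ≤ r, let ε > 0, define λ̄_i = λ_i if λ_i ≥ ε̄ and λ̄_i = ε otherwise, Φ = V·diag(λ̄_1, …, λ̄_p)·Vᵀ, and let V_2 be the last p − r columns of V. Then for every θ ∈ ℝ^{p×m} and every d ∈ ℝ^{p×m}, writing y = φ·θ + d and Θ = θ − V_2·V_2ᵀ·θ, the mixing step gives adj(Φ)·y = det(Φ)·Θ + adj(Φ)·d, where adj denotes the matrix adjugate. -/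
open Matrix

/-- Mixing step of G-DREM (eqs. (20)–(21)): with `y = φ θ + d`, the regularized
matrix `Φ` and `Θ = θ − V₂ V₂ᵀ θ`, multiplication by the adjugate of `Φ` gives
`adj(Φ) y = det(Φ) Θ + adj(Φ) d`. -/
theorem mixing_step
    (p m r : ℕ) (hr : r ≤ p)
    (V : Matrix (Fin p) (Fin p) ℝ) (hV : Vᵀ * V = 1)
    (lam : Fin p → ℝ)
    (φ : Matrix (Fin p) (Fin p) ℝ)
    (hφ : φ = V * Matrix.diagonal lam * Vᵀ)
    (hpos : ∀ i : Fin p, (i : ℕ) < r → 0 < lam i)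
    (hzero : ∀ i : Fin p, r ≤ (i : ℕ) → lam i = 0)
    (εbar ε : ℝ) (hεbar : 0 < εbar) (hε : 0 < ε)
    (hlow : ∀ i : Fin p, (i : ℕ) < r → εbar ≤ lam i)
    (lambar : Fin p → ℝ)
    (hlambar : ∀ i, lambar i = if εbar ≤ lam i then lam i else ε)
    (Φ : Matrix (Fin p) (Fin p) ℝ)
    (hΦ : Φ = V * Matrix.diagonal lambar * Vᵀ)
    (V2 : Matrix (Fin p) (Fin (p - r)) ℝ)
    (hV2 : ∀ (i : Fin p) (j : Fin (p - r)),
      V2 i j = V i ⟨r + (j : ℕ), by have := j.isLt; omega⟩) :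
    ∀ θ d : Matrix (Fin p) (Fin m) ℝ,
      Φ.adjugate * (φ * θ + d) =
        Φ.det • (θ - V2 * V2ᵀ * θ) + Φ.adjugate * d := by
  intro θ d
  have hV' : V * Vᵀ = 1 := mul_eq_one_comm.mp hV
  have hP : V2 * V2ᵀ = V * Matrix.diagonal (fun i : Fin p => if (i : ℕ) < r then (0 : ℝ) else 1) * Vᵀ := by
    ext i k
    rw [Matrix.mul_apply, Matrix.mul_apply]
    refine Fintype.sum_of_injective
      (fun j : Fin (p - r) => (⟨r + (j : ℕ), by have := j.isLt; omega⟩ : Fin p)) ?_ _ _ ?_ ?_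
    · intro a b hab
      simp only [Fin.mk.injEq] at hab
      ext
      omega
    · intro j hj
      have : (j : ℕ) < r := by
        by_contra hcon
        apply hj
        refine ⟨⟨(j : ℕ) - r, by have := j.isLt; omega⟩, ?_⟩
        ext
        simp only
        omega
      simp [Matrix.mul_diagonal, this]
    · intro j
      simp [Matrix.mul_diagonal, hV2]
  have hkey : Φ * (1 - V2 * V2ᵀ) = φ := by
    have h1 : Φ * (V2 * V2ᵀ) = V * (Matrix.diagonal lambar *
        Matrix.diagonal (fun i : Fin p => if (i : ℕ) < r then (0 : ℝ) else 1)) * Vᵀ := by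
      rw [hP, hΦ]
      calc _ = V * Matrix.diagonal lambar * (Vᵀ * V) *
            Matrix.diagonal (fun i : Fin p => if (i : ℕ) < r then (0 : ℝ) else 1) * Vᵀ := by
            simp only [Matrix.mul_assoc]
        _ = _ := by rw [hV, Matrix.mul_one]; simp only [Matrix.mul_assoc]
    rw [Matrix.mul_sub, Matrix.mul_one, h1, hΦ, hφ, ← Matrix.sub_mul, ← Matrix.mul_sub,
      Matrix.diagonal_mul_diagonal, Matrix.diagonal_sub]
    congr 3
    funext i
    by_cases h : (i : ℕ) < r
    · simp [h, hlambar, hlow i h]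
    · simp [h, hzero i (not_lt.mp h)]
  have h2 : θ - V2 * V2ᵀ * θ = (1 - V2 * V2ᵀ) * θ := by
    rw [Matrix.sub_mul, Matrix.one_mul]
  rw [Matrix.mul_add, h2]
  congr 1
  rw [← hkey, Matrix.mul_assoc, ← Matrix.mul_assoc, Matrix.adjugate_mul, Matrix.smul_mul,
    Matrix.one_mul]
end

section
/- Let k0 > 0, l > 0, let Ψ : [t0,∞) → ℝ^p be continuous, define Ψ̄(t) = ∫_{t0}^{t} e^{−l(t−s)}·Ψ(s) ds, φ̄(t) = Ψ̄(t)/(1 + Ψ̄(t)ᵀΨ̄(t)), and φ(t) = ∫_{t0}^{t} e^{−k0(t−s)}·φ̄(s)·φ̄(s)ᵀ ds. Let V_2 ∈ ℝ^{p×r̄} be a fixed matrix with orthonormal columns such that φ(t)·V_2 = 0 for all t ≥ t0. Then Ψ(t)ᵀ·V_2 = 0 for all t ≥ t0, and consequently, for every θ ∈ ℝ^{p×m}, the indistinguishable parameters Θ = θ − V_2·V_2ᵀ·θ satisfy Θᵀ·Ψ(t) = θᵀ·Ψ(t) for all t ≥ t0 (the indistinguishability condition (22)). -/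
open Matrix

theorem filter_zero (t0 k : ℝ) (g : ℝ → ℝ) (hg : ContinuousOn g (Set.Ici t0))
    (h : ∀ t, t0 ≤ t → ∫ s in t0..t, Real.exp (-k * (t - s)) * g s = 0) :
    ∀ t, t0 ≤ t → g t = 0 := by
  have hc : Continuous (fun s => g (max t0 s)) :=
    hg.comp_continuous (by fun_prop) (fun x => Set.mem_Ici.mpr (le_max_left _ _))
  have hc2 : Continuous (fun s => Real.exp (k * s) * g (max t0 s)) :=
    Continuous.mul (by fun_prop) hc
  have hF : ∀ t, t0 ≤ t → ∫ s in t0..t, Real.exp (k * s) * g (max t0 s) = 0 := by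
    intro t ht
    have h1 := h t ht
    have h2 : ∫ s in t0..t, Real.exp (-k * (t - s)) * g s
        = ∫ s in t0..t, Real.exp (-k * t) * (Real.exp (k * s) * g (max t0 s)) := by
      apply intervalIntegral.integral_congr
      intro s hs
      rw [Set.uIcc_of_le ht] at hs
      simp only
      rw [max_eq_right hs.1, ← mul_assoc, ← Real.exp_add]
      congr 2
      ring
    rw [h2, intervalIntegral.integral_const_mul] at h1
    exact (mul_eq_zero.mp h1).resolve_left (Real.exp_pos _).ne'
  intro t ht
  have d1 : HasDerivWithinAt (fun u => ∫ s in t0..u, Real.exp (k * s) * g (max t0 s))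
      (Real.exp (k * t) * g (max t0 t)) (Set.Ici t) t :=
    (hc2.integral_hasStrictDerivAt t0 t).hasDerivAt.hasDerivWithinAt
  have d2 : HasDerivWithinAt (fun u => ∫ s in t0..u, Real.exp (k * s) * g (max t0 s))
      0 (Set.Ici t) t :=
    (hasDerivWithinAt_const t (Set.Ici t) (0:ℝ)).congr
      (fun x hx => hF x (le_trans ht hx)) (hF t ht)
  have h3 := (uniqueDiffOn_Ici t t Set.self_mem_Ici).eq_deriv _ d1 d2
  rw [max_eq_right ht] at h3
  exact (mul_eq_zero.mp h3).resolve_left (Real.exp_pos _).ne'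

theorem filter_cont (p : ℕ) (t0 l : ℝ) (Ψ : ℝ → Fin p → ℝ)
    (hg : ContinuousOn Ψ (Set.Ici t0)) :
    ContinuousOn (fun t => ∫ s in t0..t, Real.exp (-l * (t - s)) • Ψ s) (Set.Ici t0) := by
  have hc : Continuous (fun s => Ψ (max t0 s)) :=
    hg.comp_continuous (by fun_prop) (fun x => Set.mem_Ici.mpr (le_max_left _ _))
  have hc2 : Continuous (fun s => Real.exp (l * s) • Ψ (max t0 s)) :=
    (show Continuous (fun s => Real.exp (l * s)) by fun_prop).smul hc
  have h4 : Continuous (fun u => ∫ s in t0..u, Real.exp (l * s) • Ψ (max t0 s)) :=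
    intervalIntegral.continuous_primitive (fun a b => hc2.intervalIntegrable a b) t0
  have h5 : Continuous (fun t => Real.exp (-l * t) •
      ∫ s in t0..t, Real.exp (l * s) • Ψ (max t0 s)) := by fun_prop
  refine h5.continuousOn.congr ?_
  intro t ht
  simp only
  rw [← intervalIntegral.integral_smul]
  apply intervalIntegral.integral_congr
  intro s hs
  rw [Set.uIcc_of_le ht] at hs
  simp only
  rw [max_eq_right hs.1, smul_smul, ← Real.exp_add]
  congr 2
  ring

/-- Indistinguishability condition (eq. (22)): if the fixed orthonormal matrix
`V₂` annihilates the extended regressor `φ(t)` for all `t ≥ t0`, then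
`Ψ(t)ᵀ V₂ = 0` and the indistinguishable parameters `Θ = θ − V₂ V₂ᵀ θ` satisfy
`Θᵀ Ψ(t) = θᵀ Ψ(t)` for all `t ≥ t0`. -/
theorem indistinguishability_condition
    (p m rbar : ℕ) (t0 k0 l : ℝ) (hk0 : 0 < k0) (hl : 0 < l)
    (Ψ : ℝ → Fin p → ℝ) (hΨc : ContinuousOn Ψ (Set.Ici t0))
    (Ψbar : ℝ → Fin p → ℝ)
    (hΨbar : ∀ t, Ψbar t = ∫ s in t0..t, Real.exp (-l * (t - s)) • Ψ s)
    (φbar : ℝ → Fin p → ℝ)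
    (hφbar : ∀ t, φbar t = (1 + Ψbar t ⬝ᵥ Ψbar t)⁻¹ • Ψbar t)
    (φ : ℝ → Matrix (Fin p) (Fin p) ℝ)
    (hφ : ∀ t i j, φ t i j =
      ∫ s in t0..t, Real.exp (-k0 * (t - s)) * (φbar s i * φbar s j))
    (V2 : Matrix (Fin p) (Fin rbar) ℝ) (hV2 : V2ᵀ * V2 = 1)
    (hker : ∀ t, t0 ≤ t → φ t * V2 = 0) :
    (∀ t, t0 ≤ t → Matrix.vecMul (Ψ t) V2 = 0) ∧
    (∀ θ : Matrix (Fin p) (Fin m) ℝ, ∀ t, t0 ≤ t →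
      (θ - V2 * V2ᵀ * θ)ᵀ.mulVec (Ψ t) = θᵀ.mulVec (Ψ t)) := by
  have hcont_int : ∀ (f : ℝ → ℝ) t, t0 ≤ t → ContinuousOn f (Set.Ici t0) →
      IntervalIntegrable f MeasureTheory.volume t0 t := by
    intro f t ht hf
    apply ContinuousOn.intervalIntegrable
    rw [Set.uIcc_of_le ht]
    exact hf.mono Set.Icc_subset_Ici_self
  have hB : ContinuousOn Ψbar (Set.Ici t0) :=
    (filter_cont p t0 l Ψ hΨc).congr (fun t _ => hΨbar t)
  have hpos : ∀ t, 0 < 1 + Ψbar t ⬝ᵥ Ψbar t := by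
    intro t
    have : 0 ≤ Ψbar t ⬝ᵥ Ψbar t := Finset.sum_nonneg (fun i _ => mul_self_nonneg _)
    linarith
  have hBi : ∀ i, ContinuousOn (fun t => Ψbar t i) (Set.Ici t0) := continuousOn_pi.mp hB
  have hPi : ∀ i, ContinuousOn (fun t => Ψ t i) (Set.Ici t0) := continuousOn_pi.mp hΨc
  have hφi : ∀ i, ContinuousOn (fun t => φbar t i) (Set.Ici t0) := by
    intro i
    have hd : ContinuousOn (fun t => 1 + Ψbar t ⬝ᵥ Ψbar t) (Set.Ici t0) := by
      unfold dotProduct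
      exact continuousOn_const.add (continuousOn_finsetSum _ (fun j _ => (hBi j).mul (hBi j)))
    refine ((hd.inv₀ (fun t _ => (hpos t).ne')).mul (hBi i)).congr ?_
    intro t _
    simp [hφbar]
  have hmain : ∀ t, t0 ≤ t → Matrix.vecMul (Ψ t) V2 = 0 := by
    suffices H : ∀ c, ∀ t, t0 ≤ t → ∑ j, Ψ t j * V2 j c = 0 by
      intro t ht
      funext c
      exact H c t ht
    intro c
    have hq : ∀ i t, t0 ≤ t → φbar t i * ∑ j, φbar t j * V2 j c = 0 := by
      intro i
      apply filter_zero t0 k0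
      · exact (hφi i).mul (continuousOn_finsetSum _ (fun j _ => (hφi j).mul continuousOn_const))
      · intro t ht
        have h1 : ∑ j, φ t i j * V2 j c = 0 := congrFun (congrFun (hker t ht) i) c
        rw [← h1]
        simp_rw [hφ, ← intervalIntegral.integral_mul_const]
        rw [← intervalIntegral.integral_finsetSum]
        · apply intervalIntegral.integral_congr
          intro s _
          simp only [Finset.mul_sum]
          exact Finset.sum_congr rfl (fun j _ => by ring)
        · intro j _
          apply hcont_int _ t ht
          exact ((Continuous.continuousOn (by fun_prop)).mul
            ((hφi i).mul (hφi j))).mul continuousOn_const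
    have hq2 : ∀ t, t0 ≤ t → ∑ j, φbar t j * V2 j c = 0 := by
      intro t ht
      have : (∑ j, φbar t j * V2 j c) * (∑ j, φbar t j * V2 j c) = 0 := by
        conv_lhs => rw [Finset.sum_mul]
        refine Finset.sum_eq_zero (fun i _ => ?_)
        rw [mul_right_comm, hq i t ht, zero_mul]
      exact mul_self_eq_zero.mp this
    have hq3 : ∀ t, t0 ≤ t → ∑ j, Ψbar t j * V2 j c = 0 := by
      intro t ht
      have h := hq2 t ht
      simp only [hφbar, Pi.smul_apply, smul_eq_mul, mul_assoc] at h
      rw [← Finset.mul_sum] at h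
      exact (mul_eq_zero.mp h).resolve_left (inv_pos.mpr (hpos t)).ne'
    apply filter_zero t0 l
    · exact continuousOn_finsetSum _ (fun j _ => (hPi j).mul continuousOn_const)
    · intro t ht
      rw [← hq3 t ht]
      have hcomp : ∀ j, Ψbar t j = ∫ s in t0..t, Real.exp (-l * (t - s)) * Ψ s j := by
        intro j
        rw [hΨbar t]
        have hint : IntervalIntegrable (fun s => Real.exp (-l * (t - s)) • Ψ s)
            MeasureTheory.volume t0 t := by
          apply ContinuousOn.intervalIntegrable
          rw [Set.uIcc_of_le ht]
          have he : Continuous (fun s => Real.exp (-l * (t - s))) := by fun_prop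
          exact he.continuousOn.smul
            (hΨc.mono Set.Icc_subset_Ici_self)
        exact ((ContinuousLinearMap.proj (R := ℝ) (φ := fun _ : Fin p => ℝ)
          j).intervalIntegral_comp_comm hint).symm
      simp_rw [hcomp, ← intervalIntegral.integral_mul_const]
      rw [← intervalIntegral.integral_finsetSum]
      · apply intervalIntegral.integral_congr
        intro s _
        simp only [Finset.mul_sum]
        exact Finset.sum_congr rfl (fun j _ => by ring)
      · intro j _
        apply hcont_int _ t ht
        have he : Continuous (fun s => Real.exp (-l * (t - s))) := by fun_prop
        exact (he.continuousOn.mul (hPi j)).mul continuousOn_const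
  refine ⟨hmain, ?_⟩
  intro θ t ht
  rw [Matrix.mulVec_transpose, Matrix.mulVec_transpose, Matrix.vecMul_sub, Matrix.mul_assoc,
    ← Matrix.vecMul_vecMul, hmain t ht, Matrix.zero_vecMul, sub_zero]
end

section
/- Let A_ref ∈ ℝ^{n×n}, B ∈ ℝ^{n×m}, let Q, P ∈ ℝ^{n×n} be symmetric positive definite with A_refᵀ·P + P·A_ref = −Q, let Ψ : [T1,∞) → ℝ^p be continuous, let κ > 0 and γ0 > 1/(2κ). Suppose e : [T1,∞) → ℝ^n and Θ̃ : [T1,∞) → ℝ^{p×m} are differentiable with e'(t) = A_ref·e(t) + B·(Θ̃(t)ᵀ·Ψ(t) − κ·Bᵀ·P·e(t)·(Ψ(t)ᵀΨ(t))) and Θ̃'(t) = −γ0·Θ̃(t) for all t ≥ T1. Then the Lyapunov function L(t) = e(t)ᵀ·P·e(t) + (1/2)·‖Θ̃(t)‖_F² satisfies L(t) ≤ e^{−c(t−T1)}·L(T1) for all t ≥ T1, where c = min{λ_min(Q)/λ_max(P), 2γ0 − 1/κ} > 0; in particular ‖e(t)‖ converges to 0 exponentially. -/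
open Matrix

lemma aux_quad {n : ℕ} (A : Matrix (Fin n) (Fin n) ℝ) (hA : A.IsHermitian) (x : Fin n → ℝ) :
    ∃ y : Fin n → ℝ, y ⬝ᵥ y = x ⬝ᵥ x ∧
      x ⬝ᵥ A.mulVec x = ∑ i, hA.eigenvalues i * (y i) ^ 2 := by
  set U : Matrix (Fin n) (Fin n) ℝ := (hA.eigenvectorUnitary : Matrix (Fin n) (Fin n) ℝ) with hU
  have hUU : U * Uᵀ = 1 := by
    have := (Matrix.mem_unitaryGroup_iff).1 hA.eigenvectorUnitary.2
    simpa [Matrix.star_eq_conjTranspose] using this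
  have hs : A = U * Matrix.diagonal hA.eigenvalues * Uᵀ := by
    have := hA.spectral_theorem
    rw [Unitary.conjStarAlgAut_apply] at this
    simpa [Matrix.star_eq_conjTranspose, Function.comp_def] using this
  refine ⟨Uᵀ.mulVec x, ?_, ?_⟩
  · rw [Matrix.dotProduct_mulVec, Matrix.vecMul_transpose, Matrix.mulVec_mulVec, hUU,
      Matrix.one_mulVec]
  · have : x ⬝ᵥ A.mulVec x
        = (Uᵀ.mulVec x) ⬝ᵥ (Matrix.diagonal hA.eigenvalues).mulVec (Uᵀ.mulVec x) := by
      conv_lhs => rw [hs]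
      rw [← Matrix.mulVec_mulVec, ← Matrix.mulVec_mulVec, Matrix.dotProduct_mulVec,
        ← Matrix.mulVec_transpose]
    rw [this, dotProduct]
    refine Finset.sum_congr rfl fun i _ => ?_
    rw [Matrix.mulVec_diagonal]; ring

lemma aux_lower {n : ℕ} (A : Matrix (Fin n) (Fin n) ℝ) (hA : A.IsHermitian) (x : Fin n → ℝ) :
    (⨅ i, hA.eigenvalues i) * (x ⬝ᵥ x) ≤ x ⬝ᵥ A.mulVec x := by
  obtain ⟨y, hy, h⟩ := aux_quad A hA x
  rw [h, ← hy, dotProduct, Finset.mul_sum]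
  refine Finset.sum_le_sum fun i _ => ?_
  have := ciInf_le (Set.finite_range hA.eigenvalues).bddBelow i
  nlinarith [mul_le_mul_of_nonneg_right this (sq_nonneg (y i))]

lemma aux_upper {n : ℕ} (A : Matrix (Fin n) (Fin n) ℝ) (hA : A.IsHermitian) (x : Fin n → ℝ) :
    x ⬝ᵥ A.mulVec x ≤ (⨆ i, hA.eigenvalues i) * (x ⬝ᵥ x) := by
  obtain ⟨y, hy, h⟩ := aux_quad A hA x
  rw [h, ← hy, dotProduct, Finset.mul_sum]
  refine Finset.sum_le_sum fun i _ => ?_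
  have := le_ciSup (Set.finite_range hA.eigenvalues).bddAbove i
  nlinarith [mul_le_mul_of_nonneg_right this (sq_nonneg (y i))]

lemma aux_infpos {n : ℕ} (hn : 0 < n) (A : Matrix (Fin n) (Fin n) ℝ) (hA : A.IsHermitian)
    (h : A.PosDef) : 0 < ⨅ i, hA.eigenvalues i := by
  have : Nonempty (Fin n) := ⟨⟨0, hn⟩⟩
  obtain ⟨i, hi⟩ := exists_eq_ciInf_of_finite (f := hA.eigenvalues)
  rw [← hi]
  exact h.eigenvalues_pos i

lemma aux_young {p m : ℕ} (κ : ℝ) (hκ : 0 < κ) (w : Fin m → ℝ) (Ψ : Fin p → ℝ)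
    (Θ : Matrix (Fin p) (Fin m) ℝ) :
    2 * (w ⬝ᵥ (Θᵀ.mulVec Ψ)) ≤
      2 * κ * (Ψ ⬝ᵥ Ψ) * (w ⬝ᵥ w) + 1 / (2 * κ) * ∑ i, ∑ j, (Θ i j) ^ 2 := by
  have h1 : 2 * (w ⬝ᵥ (Θᵀ.mulVec Ψ)) = ∑ i, ∑ j, 2 * (w j * Θ i j * Ψ i) := by
    rw [Finset.sum_comm]
    simp only [dotProduct, Matrix.mulVec, Finset.mul_sum, Matrix.transpose_apply, mul_assoc]
  have h2 : 2 * κ * (Ψ ⬝ᵥ Ψ) * (w ⬝ᵥ w) = ∑ i, ∑ j, 2 * κ * (Ψ i ^ 2 * w j ^ 2) := by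
    simp only [dotProduct]
    rw [mul_assoc, Finset.sum_mul_sum]
    simp only [Finset.mul_sum]
    refine Finset.sum_congr rfl fun i _ => Finset.sum_congr rfl fun j _ => ?_
    ring
  rw [h1, h2]
  simp only [Finset.mul_sum, ← Finset.sum_add_distrib]
  refine Finset.sum_le_sum fun i _ => Finset.sum_le_sum fun j _ => ?_
  have : 2 * κ * (Ψ i ^ 2 * w j ^ 2) + 1 / (2 * κ) * Θ i j ^ 2 - 2 * (w j * Θ i j * Ψ i)
      = 1 / (2 * κ) * (2 * κ * Ψ i * w j - Θ i j) ^ 2 := by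
    field_simp; ring
  have h3 : 0 ≤ 1 / (2 * κ) * (2 * κ * Ψ i * w j - Θ i j) ^ 2 := by positivity
  linarith

lemma aux_deriv {n : ℕ} (P : Matrix (Fin n) (Fin n) ℝ) (hP : P.IsHermitian)
    (e : ℝ → Fin n → ℝ) (e' : Fin n → ℝ) (t : ℝ) (he : HasDerivAt e e' t) :
    HasDerivAt (fun s => e s ⬝ᵥ P.mulVec (e s)) (2 * (P.mulVec (e t) ⬝ᵥ e')) t := by
  have hi := hasDerivAt_pi.1 he
  have hPe : ∀ i, HasDerivAt (fun s => P.mulVec (e s) i) (P.mulVec e' i) t := by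
    intro i
    simp only [Matrix.mulVec, dotProduct]
    exact HasDerivAt.fun_sum fun j _ => (hi j).const_mul _
  have h : HasDerivAt (fun s => e s ⬝ᵥ P.mulVec (e s))
      (∑ i, (e' i * P.mulVec (e t) i + e t i * P.mulVec e' i)) t := by
    simp only [dotProduct]
    exact HasDerivAt.fun_sum fun j _ => (hi j).mul (hPe j)
  convert h using 1
  have hPt : Pᵀ = P := by rw [← Matrix.conjTranspose_eq_transpose_of_trivial]; exact hP
  have h2 : e t ⬝ᵥ P.mulVec e' = P.mulVec (e t) ⬝ᵥ e' := by
    rw [Matrix.dotProduct_mulVec, ← Matrix.mulVec_transpose, hPt]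
  rw [Finset.sum_add_distrib]
  change _ = e' ⬝ᵥ P.mulVec (e t) + e t ⬝ᵥ P.mulVec e'
  rw [h2, dotProduct_comm e']; ring


/-- Lyapunov decay (proof of Theorem 1, second part): for the closed loop
`ė = A_ref e + B(Θ̃ᵀ Ψ − κ BᵀP e ΨᵀΨ)` and `Θ̃' = −γ0 Θ̃` with
`A_refᵀP + P A_ref = −Q`, `γ0 > 1/(2κ)`, the Lyapunov function
`L = eᵀPe + ½‖Θ̃‖_F²` satisfies `L(t) ≤ e^{−c(t−T1)} L(T1)` with
`c = min{λ_min(Q)/λ_max(P), 2γ0 − 1/κ} > 0`; in particular `‖e‖ → 0`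
exponentially. -/
theorem lyapunov_exponential_decay
    (n m p : ℕ) (hn : 0 < n) (T1 κ γ0 : ℝ) (hκ : 0 < κ) (hγ0 : 1 / (2 * κ) < γ0)
    (Aref : Matrix (Fin n) (Fin n) ℝ) (B : Matrix (Fin n) (Fin m) ℝ)
    (Q P : Matrix (Fin n) (Fin n) ℝ)
    (hQsymm : Q.IsHermitian) (hPsymm : P.IsHermitian)
    (hQpd : Q.PosDef) (hPpd : P.PosDef)
    (hLyap : Arefᵀ * P + P * Aref = -Q)
    (Ψ : ℝ → Fin p → ℝ) (hΨc : ContinuousOn Ψ (Set.Ici T1))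
    (e : ℝ → Fin n → ℝ) (Θt : ℝ → Matrix (Fin p) (Fin m) ℝ)
    (he : ∀ t, T1 ≤ t →
      HasDerivAt e (Aref.mulVec (e t) +
        B.mulVec ((Θt t)ᵀ.mulVec (Ψ t) -
          (κ * (Ψ t ⬝ᵥ Ψ t)) • (Bᵀ.mulVec (P.mulVec (e t))))) t)
    (hΘ : ∀ t, T1 ≤ t → ∀ i j,
      HasDerivAt (fun s => Θt s i j) (-γ0 * Θt t i j) t) :
    ∀ c : ℝ,
      c = min ((⨅ i, hQsymm.eigenvalues i) / (⨆ i, hPsymm.eigenvalues i))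
        (2 * γ0 - 1 / κ) →
      0 < c ∧
      (∀ t, T1 ≤ t →
        e t ⬝ᵥ P.mulVec (e t) + (1 / 2) * ∑ i, ∑ j, (Θt t i j) ^ 2 ≤
          Real.exp (-c * (t - T1)) *
            (e T1 ⬝ᵥ P.mulVec (e T1) + (1 / 2) * ∑ i, ∑ j, (Θt T1 i j) ^ 2)) ∧
      (∃ C, 0 ≤ C ∧ ∀ t, T1 ≤ t →
        ‖e t‖ ≤ C * Real.exp (-(c / 2) * (t - T1))) := by
  intro c hc
  have hQ0 := aux_infpos hn Q hQsymm hQpd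
  have hP0 := aux_infpos hn P hPsymm hPpd
  set lq := ⨅ i, hQsymm.eigenvalues i with hlq
  set lp := ⨅ i, hPsymm.eigenvalues i with hlp
  set up := ⨆ i, hPsymm.eigenvalues i with hup
  have hU0 : 0 < up := lt_of_lt_of_le hP0
    ((ciInf_le (Set.finite_range hPsymm.eigenvalues).bddBelow ⟨0, hn⟩).trans
      (le_ciSup (Set.finite_range hPsymm.eigenvalues).bddAbove ⟨0, hn⟩))
  have hκ2 : 1 / κ = 2 * (1 / (2 * κ)) := by field_simp
  have hc0 : 0 < c := by
    rw [hc]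
    refine lt_min (div_pos hQ0 hU0) ?_
    rw [hκ2]; linarith
  have hc1 : c * up ≤ lq := by
    rw [← le_div_iff₀ hU0, hc]; exact min_le_left _ _
  have hc2 : c ≤ 2 * γ0 - 1 / κ := by rw [hc]; exact min_le_right _ _
  have hPt : Pᵀ = P := by rw [← Matrix.conjTranspose_eq_transpose_of_trivial]; exact hPsymm
  set L : ℝ → ℝ := fun t => e t ⬝ᵥ P.mulVec (e t) + (1 / 2) * ∑ i, ∑ j, (Θt t i j) ^ 2 with hL
  have key : ∀ t, T1 ≤ t → ∃ L', HasDerivAt L L' t ∧ L' ≤ -c * L t := by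
    intro t ht
    have d1 := aux_deriv P hPsymm e _ t (he t ht)
    have d2 : HasDerivAt (fun s => ∑ i, ∑ j, (Θt s i j) ^ 2)
        (-2 * γ0 * ∑ i, ∑ j, (Θt t i j) ^ 2) t := by
      have : HasDerivAt (fun s => ∑ i, ∑ j, (Θt s i j) ^ 2)
        (∑ i, ∑ j, (2 : ℕ) * (Θt t i j) ^ (2 - 1) * (-γ0 * Θt t i j)) t :=
        HasDerivAt.fun_sum fun i _ => HasDerivAt.fun_sum fun j _ => (hΘ t ht i j).fun_pow 2
      convert this using 1
      simp only [Finset.mul_sum]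
      refine Finset.sum_congr rfl fun i _ => Finset.sum_congr rfl fun j _ => ?_
      push_cast; ring
    refine ⟨_, d1.add (d2.const_mul (1 / 2)), ?_⟩
    set w := Bᵀ.mulVec (P.mulVec (e t)) with hw
    have hA : 2 * (P.mulVec (e t) ⬝ᵥ Aref.mulVec (e t)) = -(e t ⬝ᵥ Q.mulVec (e t)) := by
      have h := congrArg (fun M => e t ⬝ᵥ M.mulVec (e t)) hLyap
      simp only [Matrix.add_mulVec, Matrix.neg_mulVec, dotProduct_add, dotProduct_neg,
        ← Matrix.mulVec_mulVec] at h
      rw [← h]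
      have a1 : e t ⬝ᵥ Arefᵀ.mulVec (P.mulVec (e t)) = P.mulVec (e t) ⬝ᵥ Aref.mulVec (e t) := by
        rw [Matrix.dotProduct_mulVec, Matrix.vecMul_transpose, dotProduct_comm]
      have a2 : e t ⬝ᵥ P.mulVec (Aref.mulVec (e t)) = P.mulVec (e t) ⬝ᵥ Aref.mulVec (e t) := by
        rw [Matrix.dotProduct_mulVec, ← Matrix.mulVec_transpose, hPt]
      rw [a1, a2]; ring
    have hB : ∀ v, P.mulVec (e t) ⬝ᵥ B.mulVec v = w ⬝ᵥ v := by
      intro v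
      rw [Matrix.dotProduct_mulVec, ← Matrix.mulVec_transpose]
    have hy := aux_young κ hκ w (Ψ t) (Θt t)
    have hq := aux_lower Q hQsymm (e t)
    have hp := aux_upper P hPsymm (e t)
    have hS : 0 ≤ ∑ i, ∑ j, (Θt t i j) ^ 2 :=
      Finset.sum_nonneg fun i _ => Finset.sum_nonneg fun j _ => sq_nonneg _
    have hee : 0 ≤ e t ⬝ᵥ e t := Finset.sum_nonneg fun i _ => mul_self_nonneg _
    rw [dotProduct_add, hB, dotProduct_sub, dotProduct_smul, smul_eq_mul]
    simp only [hL]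
    have b1 := mul_le_mul_of_nonneg_left hp hc0.le
    have b2 := mul_le_mul_of_nonneg_right hc1 hee
    have b3 := mul_le_mul_of_nonneg_right hc2 hS
    rw [hκ2] at b3
    rw [← hlq] at hq
    rw [← hup] at b1
    nlinarith
  have hLd : ∀ t, T1 ≤ t → L t ≤ Real.exp (-c * (t - T1)) * L T1 := by
    have hg : ∀ t, T1 ≤ t → ∃ g', HasDerivAt (fun s => Real.exp (c * (s - T1)) * L s) g' t
        ∧ g' ≤ 0 := by
      intro t ht
      obtain ⟨L', h1, h2⟩ := key t ht
      have h3 : HasDerivAt (fun s => Real.exp (c * (s - T1)))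
          (Real.exp (c * (t - T1)) * (c * 1)) t :=
        (((hasDerivAt_id t).sub_const T1).const_mul c).exp
      refine ⟨_, h3.mul h1, ?_⟩
      have := mul_le_mul_of_nonneg_left h2 (Real.exp_pos (c * (t - T1))).le
      nlinarith
    have hanti : AntitoneOn (fun s => Real.exp (c * (s - T1)) * L s) (Set.Ici T1) := by
      apply antitoneOn_of_deriv_nonpos (convex_Ici T1)
      · intro t ht
        obtain ⟨_, h, _⟩ := hg t ht
        exact h.continuousAt.continuousWithinAt
      · intro t ht
        obtain ⟨_, h, _⟩ := hg t (interior_subset ht)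
        exact h.differentiableAt.differentiableWithinAt
      · intro t ht
        obtain ⟨_, h, h'⟩ := hg t (interior_subset ht)
        rw [h.deriv]; exact h'
    intro t ht
    have h := hanti (Set.self_mem_Ici) ht ht
    simp only [sub_self, mul_zero, Real.exp_zero, one_mul] at h
    calc L t = Real.exp (-c * (t - T1)) * (Real.exp (c * (t - T1)) * L t) := by
          rw [← mul_assoc, ← Real.exp_add]; simp
      _ ≤ _ := mul_le_mul_of_nonneg_left h (Real.exp_pos _).le
  refine ⟨hc0, hLd, Real.sqrt (L T1 / lp), Real.sqrt_nonneg _, ?_⟩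
  intro t ht
  have hle : lp * (e t ⬝ᵥ e t) ≤ L t := by
    have h1 := aux_lower P hPsymm (e t)
    have hS : 0 ≤ ∑ i, ∑ j, (Θt t i j) ^ 2 :=
      Finset.sum_nonneg fun i _ => Finset.sum_nonneg fun j _ => sq_nonneg _
    simp only [hL]
    linarith
  have h2 : e t ⬝ᵥ e t ≤ L T1 / lp * Real.exp (-c * (t - T1)) := by
    have := hLd t ht
    rw [div_mul_eq_mul_div, le_div_iff₀ hP0]
    linarith
  have h3 : Real.exp (-c * (t - T1)) = Real.exp (-(c / 2) * (t - T1)) ^ 2 := by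
    rw [← Real.exp_nat_mul]; congr 1; push_cast; ring
  have h4 : Real.sqrt (L T1 / lp) * Real.exp (-(c / 2) * (t - T1))
      = Real.sqrt (L T1 / lp * Real.exp (-c * (t - T1))) := by
    rw [h3, Real.sqrt_mul' _ (sq_nonneg _), Real.sqrt_sq (Real.exp_pos _).le]
  rw [h4]
  refine (pi_norm_le_iff_of_nonneg (Real.sqrt_nonneg _)).2 fun i => ?_
  rw [Real.norm_eq_abs]
  apply Real.abs_le_sqrt
  refine le_trans ?_ h2
  rw [pow_two]
  exact Finset.single_le_sum (f := fun i => e t i * e t i)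
    (fun i _ => mul_self_nonneg _) (Finset.mem_univ i)
end

section
/- (Theorem 1) Let A_ref ∈ ℝ^{n×n}, B ∈ ℝ^{n×m}, let Q, P ∈ ℝ^{n×n} be symmetric positive definite with A_refᵀ·P + P·A_ref = −Q, let Ψ : [T1,∞) → ℝ^p be continuous, let κ > 0, γ0 > 1/(2κ), θ ∈ ℝ^{p×m} with ‖θ‖_F ≤ θ_max. Let V_2 ∈ ℝ^{p×r̄} have orthonormal columns with Ψ(t)ᵀ·V_2 = 0 for all t ≥ T1, and set Θ = θ − V_2·V_2ᵀ·θ. Suppose e : [T1,∞) → ℝ^n and θ̂ : [T1,∞) → ℝ^{p×m} are differentiable with e'(t) = A_ref·e(t) + B·((θ̂(t) − θ)ᵀ·Ψ(t) − κ·Bᵀ·P·e(t)·(Ψ(t)ᵀΨ(t))) and θ̂'(t) = −γ0·(θ̂(t) − Θ) for all t ≥ T1. Then: (i) there exist C ≥ 0 and c > 0 (c = (1/2)·min{λ_min(Q)/λ_max(P), 2γ0 − 1/κ}) such that ‖e(t)‖ ≤ C·e^{−c(t−T1)} for all t ≥ T1, and (ii) ‖θ̂(t) − θ‖_F ≤ e^{−(γ0/2)(t−T1)}·‖θ̂(T1)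 − θ‖_F + θ_max for all t ≥ T1. -/
open Matrix

/-- Frobenius norm of a real matrix. -/
noncomputable def frobNorm {p m : ℕ} (M : Matrix (Fin p) (Fin m) ℝ) : ℝ :=
  Real.sqrt (∑ i, ∑ j, (M i j) ^ 2)

theorem quad_spec {n : ℕ} (A : Matrix (Fin n) (Fin n) ℝ) (hA : A.IsHermitian) (x : Fin n → ℝ) :
    ∃ y : Fin n → ℝ, x ⬝ᵥ x = ∑ i, y i ^ 2 ∧
      x ⬝ᵥ (A *ᵥ x) = ∑ i, hA.eigenvalues i * y i ^ 2 := by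
  let U : Matrix (Fin n) (Fin n) ℝ := hA.eigenvectorUnitary
  have hU : U * star U = 1 := Unitary.coe_mul_star_self _
  have hs : A = U * diagonal hA.eigenvalues * star U := by
    have := hA.spectral_theorem
    rw [Unitary.conjStarAlgAut_apply] at this
    exact this
  have hst : star U = Uᵀ := by rw [star_eq_conjTranspose, conjTranspose_eq_transpose_of_trivial]
  rw [hst] at hs hU
  refine ⟨Uᵀ *ᵥ x, ?_, ?_⟩
  · have : (Uᵀ *ᵥ x) ⬝ᵥ (Uᵀ *ᵥ x) = x ⬝ᵥ x := by
      rw [dotProduct_mulVec, vecMul_transpose, mulVec_mulVec, hU, one_mulVec]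
    rw [← this]; simp [dotProduct, sq]
  · have : (Uᵀ *ᵥ x) ⬝ᵥ (diagonal hA.eigenvalues *ᵥ (Uᵀ *ᵥ x)) = x ⬝ᵥ (A *ᵥ x) := by
      conv_rhs => rw [hs]
      rw [← mulVec_mulVec, ← mulVec_mulVec, dotProduct_mulVec x U, ← mulVec_transpose]
    rw [← this]
    simp only [dotProduct, mulVec_diagonal]
    exact Finset.sum_congr rfl fun i _ => by ring

theorem quad_lower {n : ℕ} (A : Matrix (Fin n) (Fin n) ℝ) (hA : A.IsHermitian) (x : Fin n → ℝ) :
    (⨅ i, hA.eigenvalues i) * (x ⬝ᵥ x) ≤ x ⬝ᵥ (A *ᵥ x) := by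
  obtain ⟨y, h1, h2⟩ := quad_spec A hA x
  rw [h1, h2, Finset.mul_sum]
  exact Finset.sum_le_sum fun i _ => mul_le_mul_of_nonneg_right
    (ciInf_le (Set.finite_range _).bddBelow i) (sq_nonneg _)

theorem quad_upper {n : ℕ} (A : Matrix (Fin n) (Fin n) ℝ) (hA : A.IsHermitian) (x : Fin n → ℝ) :
    x ⬝ᵥ (A *ᵥ x) ≤ (⨆ i, hA.eigenvalues i) * (x ⬝ᵥ x) := by
  obtain ⟨y, h1, h2⟩ := quad_spec A hA x
  rw [h1, h2, Finset.mul_sum]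
  exact Finset.sum_le_sum fun i _ => mul_le_mul_of_nonneg_right
    (le_ciSup (Set.finite_range _).bddAbove i) (sq_nonneg _)

theorem iInf_pos_eig {n : ℕ} (hn : 0 < n) (A : Matrix (Fin n) (Fin n) ℝ) (hA : A.IsHermitian)
    (hp : A.PosDef) : 0 < ⨅ i, hA.eigenvalues i := by
  have : Nonempty (Fin n) := ⟨⟨0, hn⟩⟩
  obtain ⟨i, hi⟩ := exists_eq_ciInf_of_finite (f := hA.eigenvalues)
  rw [← hi]; exact hp.eigenvalues_pos i

theorem iSup_pos_eig {n : ℕ} (hn : 0 < n) (A : Matrix (Fin n) (Fin n) ℝ) (hA : A.IsHermitian)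
    (hp : A.PosDef) : 0 < ⨆ i, hA.eigenvalues i := by
  have : Nonempty (Fin n) := ⟨⟨0, hn⟩⟩
  obtain ⟨i, hi⟩ := exists_eq_ciSup_of_finite (f := hA.eigenvalues)
  rw [← hi]; exact hp.eigenvalues_pos i

theorem frob_eq {p m : ℕ} (M : Matrix (Fin p) (Fin m) ℝ) :
    frobNorm M = ‖(WithLp.toLp 2 (fun ij : Fin p × Fin m => M ij.1 ij.2) : EuclideanSpace ℝ _)‖ := by
  rw [EuclideanSpace.norm_eq, frobNorm, Fintype.sum_prod_type]
  simp

theorem frob_sub_le {p m : ℕ} (a b : ℝ) (ha : 0 ≤ a) (hb : 0 ≤ b)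
    (M N : Matrix (Fin p) (Fin m) ℝ) :
    frobNorm (a • M - b • N) ≤ a * frobNorm M + b * frobNorm N := by
  simp only [frob_eq]
  have := norm_sub_le (a • (WithLp.toLp 2 (fun ij : Fin p × Fin m => M ij.1 ij.2) : EuclideanSpace ℝ _))
    (b • (WithLp.toLp 2 (fun ij : Fin p × Fin m => N ij.1 ij.2) : EuclideanSpace ℝ _))
  rw [norm_smul, norm_smul, Real.norm_of_nonneg ha, Real.norm_of_nonneg hb] at this
  exact this

theorem sq_trace {p m : ℕ} (M : Matrix (Fin p) (Fin m) ℝ) :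
    ∑ i, ∑ j, (M i j) ^ 2 = (Mᵀ * M).trace := by
  simp only [trace, diag, mul_apply, transpose_apply]
  rw [Finset.sum_comm]
  simp [sq]

theorem frob_proj {p m r : ℕ} (V : Matrix (Fin p) (Fin r) ℝ) (hV : Vᵀ * V = 1)
    (θ : Matrix (Fin p) (Fin m) ℝ) : frobNorm (V * Vᵀ * θ) ≤ frobNorm θ := by
  apply Real.sqrt_le_sqrt
  have h0 : 0 ≤ ∑ i, ∑ j, ((θ - V * Vᵀ * θ) i j) ^ 2 := by positivity
  rw [sq_trace] at h0 ⊢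
  rw [sq_trace]
  have e1 : (V * Vᵀ * θ)ᵀ * (V * Vᵀ * θ) = θᵀ * (V * Vᵀ * θ) := by
    simp only [transpose_mul, transpose_transpose, Matrix.mul_assoc]
    rw [← Matrix.mul_assoc Vᵀ V, hV, Matrix.one_mul]
  have e2 : (V * Vᵀ * θ)ᵀ * θ = θᵀ * (V * Vᵀ * θ) := by
    simp only [transpose_mul, transpose_transpose, Matrix.mul_assoc]
  rw [transpose_sub, Matrix.sub_mul, Matrix.mul_sub, Matrix.mul_sub, e1, e2] at h0
  rw [e1]
  simp only [trace_sub] at h0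
  linarith

/-- Exponential decay from a differential inequality. -/
theorem decay {L L' : ℝ → ℝ} {T k : ℝ} (hL : ∀ t, T ≤ t → HasDerivAt L (L' t) t)
    (h : ∀ t, T ≤ t → L' t ≤ -k * L t) (t : ℝ) (ht : T ≤ t) :
    L t ≤ L T * Real.exp (-k * (t - T)) := by
  have hd : ∀ s, T ≤ s → HasDerivAt (fun s => L s * Real.exp (k * (s - T)))
      (L' s * Real.exp (k * (s - T)) + L s * (Real.exp (k * (s - T)) * (k * 1))) s := by
    intro s hs
    exact (hL s hs).mul ((((hasDerivAt_id s).sub_const T).const_mul k).exp)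
  have ha : AntitoneOn (fun s => L s * Real.exp (k * (s - T))) (Set.Ici T) := by
    apply antitoneOn_of_deriv_nonpos (convex_Ici T)
    · exact fun s hs => (hd s hs).continuousAt.continuousWithinAt
    · intro s hs
      rw [interior_Ici] at hs
      exact (hd s (le_of_lt hs)).differentiableAt.differentiableWithinAt
    · intro s hs
      rw [interior_Ici] at hs
      rw [(hd s (le_of_lt hs)).deriv]
      have := h s (le_of_lt hs)
      have := mul_le_mul_of_nonneg_right this (Real.exp_pos (k * (s - T))).le
      linarith
  have := ha (Set.mem_Ici.2 le_rfl) (Set.mem_Ici.2 ht) ht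
  simp only [sub_self, mul_zero, Real.exp_zero, mul_one] at this
  have h2 := mul_le_mul_of_nonneg_right this (Real.exp_pos (-k * (t - T))).le
  rwa [mul_assoc, ← Real.exp_add, show k * (t - T) + -k * (t - T) = 0 by ring, Real.exp_zero,
    mul_one] at h2

theorem lyap_deriv {n : ℕ} (P : Matrix (Fin n) (Fin n) ℝ) (hP : P.IsHermitian)
    (e : ℝ → Fin n → ℝ) (e' : Fin n → ℝ) (t : ℝ) (he : HasDerivAt e e' t) :
    HasDerivAt (fun s => e s ⬝ᵥ (P *ᵥ e s)) (2 * (e' ⬝ᵥ (P *ᵥ e t))) t := by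
  rw [hasDerivAt_pi] at he
  have h1 : HasDerivAt (fun s => ∑ i, e s i * ∑ j, P i j * e s j)
     (∑ i, (e' i * ∑ j, P i j * e t j + e t i * ∑ j, P i j * e' j)) t :=
    HasDerivAt.fun_sum fun i _ => (he i).mul (HasDerivAt.fun_sum fun j _ => (he j).const_mul _)
  have h2 : e t ⬝ᵥ (P *ᵥ e') = e' ⬝ᵥ (P *ᵥ e t) := by
    have hPt : Pᵀ = P := by simpa [IsHermitian, conjTranspose_eq_transpose_of_trivial] using hP
    rw [dotProduct_mulVec, ← mulVec_transpose, hPt, dotProduct_comm]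
  convert h1 using 1
  · rfl
  rw [Finset.sum_add_distrib, two_mul]
  nth_rw 2 [← h2]
  rfl

theorem quad_lyap {n : ℕ} (A P Q : Matrix (Fin n) (Fin n) ℝ)
    (hP : P.IsHermitian) (h : Aᵀ * P + P * A = -Q) (x : Fin n → ℝ) :
    2 * ((A *ᵥ x) ⬝ᵥ (P *ᵥ x)) = - (x ⬝ᵥ (Q *ᵥ x)) := by
  have hPt : Pᵀ = P := by simpa [IsHermitian, conjTranspose_eq_transpose_of_trivial] using hP
  have h1 : x ⬝ᵥ ((Aᵀ * P + P * A) *ᵥ x) = - (x ⬝ᵥ (Q *ᵥ x)) := by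
    rw [h, neg_mulVec, dotProduct_neg]
  rw [add_mulVec, dotProduct_add, ← mulVec_mulVec, ← mulVec_mulVec, dotProduct_mulVec x Aᵀ,
    vecMul_transpose, dotProduct_mulVec x P, ← mulVec_transpose, hPt,
    dotProduct_comm (P *ᵥ x)] at h1
  linarith

theorem cross_bound {p m : ℕ} (κ : ℝ) (hκ : 0 < κ) (M : Matrix (Fin p) (Fin m) ℝ)
    (ψ : Fin p → ℝ) (a : Fin m → ℝ) :
    2 * ((Mᵀ *ᵥ ψ - (κ * (ψ ⬝ᵥ ψ)) • a) ⬝ᵥ a) ≤ (1 / κ) * ∑ i, ∑ j, (M i j) ^ 2 := by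
  have h : 2 * ((Mᵀ *ᵥ ψ - (κ * (ψ ⬝ᵥ ψ)) • a) ⬝ᵥ a) =
      ∑ i, ∑ j, (2 * (M i j * ψ i - κ * (ψ i * ψ i) * a j) * a j) := by
    rw [Finset.sum_comm]
    simp only [dotProduct, mulVec, transpose_apply, Pi.sub_apply, Pi.smul_apply, smul_eq_mul]
    rw [Finset.mul_sum]
    refine Finset.sum_congr rfl fun j _ => ?_
    rw [← Finset.sum_mul, ← Finset.mul_sum, Finset.sum_sub_distrib, ← Finset.sum_mul,
      ← Finset.mul_sum]
    ring
  rw [h, Finset.mul_sum]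
  refine Finset.sum_le_sum fun i _ => ?_
  rw [Finset.mul_sum]
  refine Finset.sum_le_sum fun j _ => ?_
  have h3 : 0 ≤ (1 / κ) * ((M i j - κ * ψ i * a j) ^ 2 + κ ^ 2 * (ψ i * a j) ^ 2) := by positivity
  have h4 : (1 / κ) * ((M i j - κ * ψ i * a j) ^ 2 + κ ^ 2 * (ψ i * a j) ^ 2) =
     1 / κ * M i j ^ 2 - (2 * (M i j * ψ i - κ * (ψ i * ψ i) * a j) * a j) := by
    field_simp
    ring
  linarith

/-- Theorem 1: for the closed loop
`ė = A_ref e + B((θ̂ − θ)ᵀ Ψ − κ BᵀP e ΨᵀΨ)` with the adaptive law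
`θ̂' = −γ0 (θ̂ − Θ)`, `Θ = θ − V₂ V₂ᵀ θ`, `Ψᵀ V₂ = 0`,
`A_refᵀP + P A_ref = −Q` and `γ0 > 1/(2κ)`:
(i) the tracking error converges to zero exponentially with rate
`c = ½ min{λ_min(Q)/λ_max(P), 2γ0 − 1/κ} > 0`, and
(ii) `‖θ̂(t) − θ‖_F ≤ e^{−(γ0/2)(t−T1)} ‖θ̂(T1) − θ‖_F + θ_max`. -/
theorem theorem1_exponential_stability
    (n m p rbar : ℕ) (hn : 0 < n) (T1 κ γ0 θmax : ℝ)
    (hκ : 0 < κ) (hγ0 : 1 / (2 * κ) < γ0)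
    (Aref : Matrix (Fin n) (Fin n) ℝ) (B : Matrix (Fin n) (Fin m) ℝ)
    (Q P : Matrix (Fin n) (Fin n) ℝ)
    (hQsymm : Q.IsHermitian) (hPsymm : P.IsHermitian)
    (hQpd : Q.PosDef) (hPpd : P.PosDef)
    (hLyap : Arefᵀ * P + P * Aref = -Q)
    (Ψ : ℝ → Fin p → ℝ) (hΨc : ContinuousOn Ψ (Set.Ici T1))
    (θ : Matrix (Fin p) (Fin m) ℝ) (hθ : frobNorm θ ≤ θmax)
    (V2 : Matrix (Fin p) (Fin rbar) ℝ) (hV2 : V2ᵀ * V2 = 1)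
    (hperp : ∀ t, T1 ≤ t → Matrix.vecMul (Ψ t) V2 = 0)
    (Θ : Matrix (Fin p) (Fin m) ℝ) (hΘ : Θ = θ - V2 * V2ᵀ * θ)
    (e : ℝ → Fin n → ℝ) (θhat : ℝ → Matrix (Fin p) (Fin m) ℝ)
    (he : ∀ t, T1 ≤ t →
      HasDerivAt e (Aref.mulVec (e t) +
        B.mulVec ((θhat t - θ)ᵀ.mulVec (Ψ t) -
          (κ * (Ψ t ⬝ᵥ Ψ t)) • (Bᵀ.mulVec (P.mulVec (e t))))) t)
    (hθhat : ∀ t, T1 ≤ t → ∀ i j,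
      HasDerivAt (fun s => θhat s i j) (-γ0 * (θhat t i j - Θ i j)) t) :
    (∀ c : ℝ,
      c = (1 / 2) * min ((⨅ i, hQsymm.eigenvalues i) / (⨆ i, hPsymm.eigenvalues i))
        (2 * γ0 - 1 / κ) →
      0 < c ∧ ∃ C, 0 ≤ C ∧ ∀ t, T1 ≤ t →
        ‖e t‖ ≤ C * Real.exp (-c * (t - T1))) ∧
    (∀ t, T1 ≤ t →
      frobNorm (θhat t - θ) ≤
        Real.exp (-(γ0 / 2) * (t - T1)) * frobNorm (θhat T1 - θ) + θmax) := by
  have hγpos : 0 < γ0 := lt_trans (by positivity) hγ0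
  have hγκ : 0 < 2 * γ0 - 1 / κ := by
    have : 1 / κ = 2 * (1 / (2 * κ)) := by field_simp
    linarith
  refine ⟨?_, ?_⟩
  · intro c hc
    have hq := iInf_pos_eig hn Q hQsymm hQpd
    have hpmin := iInf_pos_eig hn P hPsymm hPpd
    have hpmax := iSup_pos_eig hn P hPsymm hPpd
    have hc1 : 2 * c ≤ (⨅ i, hQsymm.eigenvalues i) / (⨆ i, hPsymm.eigenvalues i) := by
      rw [hc]
      have := min_le_left ((⨅ i, hQsymm.eigenvalues i) / (⨆ i, hPsymm.eigenvalues i))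
        (2 * γ0 - 1 / κ)
      linarith
    have hc2 : 2 * c ≤ 2 * γ0 - 1 / κ := by
      rw [hc]
      have := min_le_right ((⨅ i, hQsymm.eigenvalues i) / (⨆ i, hPsymm.eigenvalues i))
        (2 * γ0 - 1 / κ)
      linarith
    have hcpos : 0 < c := by
      rw [hc]
      have := lt_min (div_pos hq hpmax) hγκ
      linarith
    refine ⟨hcpos, ?_⟩
    -- the Lyapunov function
    have hd : ∀ t, T1 ≤ t → HasDerivAt
        (fun s => e s ⬝ᵥ (P *ᵥ e s) + ∑ i, ∑ j, (θhat s i j - Θ i j) ^ 2)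
        (2 * ((Aref.mulVec (e t) +
          B.mulVec ((θhat t - θ)ᵀ.mulVec (Ψ t) -
          (κ * (Ψ t ⬝ᵥ Ψ t)) • (Bᵀ.mulVec (P.mulVec (e t))))) ⬝ᵥ (P *ᵥ e t)) +
          ∑ i, ∑ j, (-2 * γ0) * (θhat t i j - Θ i j) ^ 2) t := by
      intro t ht
      refine (lyap_deriv P hPsymm e _ t (he t ht)).add ?_
      refine HasDerivAt.fun_sum fun i _ => HasDerivAt.fun_sum fun j _ => ?_
      have := ((hθhat t ht i j).sub_const (Θ i j)).pow 2
      refine HasDerivAt.congr_deriv this ?_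
      push_cast
      ring
    have hdec : ∀ t, T1 ≤ t → (2 * ((Aref.mulVec (e t) +
          B.mulVec ((θhat t - θ)ᵀ.mulVec (Ψ t) -
          (κ * (Ψ t ⬝ᵥ Ψ t)) • (Bᵀ.mulVec (P.mulVec (e t))))) ⬝ᵥ (P *ᵥ e t)) +
          ∑ i, ∑ j, (-2 * γ0) * (θhat t i j - Θ i j) ^ 2) ≤
        -(2 * c) * (e t ⬝ᵥ (P *ᵥ e t) + ∑ i, ∑ j, (θhat t i j - Θ i j) ^ 2) := by
      intro t ht
      have hind : (θhat t - θ)ᵀ *ᵥ (Ψ t) = (θhat t - Θ)ᵀ *ᵥ (Ψ t) := by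
        have h0 : (V2 * V2ᵀ * θ)ᵀ *ᵥ (Ψ t) = 0 := by
          rw [mulVec_transpose, Matrix.mul_assoc, ← vecMul_vecMul, hperp t ht, zero_vecMul]
        have h1 : θhat t - Θ = (θhat t - θ) + V2 * V2ᵀ * θ := by rw [hΘ]; abel
        rw [h1, transpose_add, add_mulVec, h0, add_zero]
      rw [hind, add_dotProduct, mul_add, quad_lyap Aref P Q hPsymm hLyap]
      have hB : ∀ w : Fin m → ℝ, (B *ᵥ w) ⬝ᵥ (P *ᵥ e t) = w ⬝ᵥ (Bᵀ *ᵥ (P *ᵥ e t)) := by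
        intro w
        rw [dotProduct_mulVec w, vecMul_transpose]
      rw [hB]
      have hx := cross_bound κ hκ (θhat t - Θ) (Ψ t) (Bᵀ *ᵥ (P *ᵥ e t))
      simp only [← Finset.mul_sum]
      simp only [Matrix.sub_apply] at hx
      have hS : 0 ≤ ∑ i, ∑ j, (θhat t i j - Θ i j) ^ 2 := by positivity
      set S := ∑ i, ∑ j, (θhat t i j - Θ i j) ^ 2
      have hQ := quad_lower Q hQsymm (e t)
      have hP := quad_upper P hPsymm (e t)
      have hee : 0 ≤ e t ⬝ᵥ e t := by
        simp only [dotProduct]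
        exact Finset.sum_nonneg fun i _ => mul_self_nonneg _
      rw [le_div_iff₀ hpmax] at hc1
      have a1 := mul_le_mul_of_nonneg_left hP (by linarith : 0 ≤ 2 * c)
      have a2 := mul_le_mul_of_nonneg_right hc1 hee
      have a3 := mul_le_mul_of_nonneg_right hc2 hS
      nlinarith
    have hmain := decay hd hdec
    set L0 := e T1 ⬝ᵥ (P *ᵥ e T1) + ∑ i, ∑ j, (θhat T1 i j - Θ i j) ^ 2 with hL0
    set lam := ⨅ i, hPsymm.eigenvalues i with hlam
    refine ⟨Real.sqrt (L0 / lam), Real.sqrt_nonneg _, ?_⟩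
    intro t ht
    have hm := hmain t ht
    have hlow := quad_lower P hPsymm (e t)
    have hS : 0 ≤ ∑ i, ∑ j, (θhat t i j - Θ i j) ^ 2 := by positivity
    have hexp : Real.exp (-(2 * c) * (t - T1)) = Real.exp (-c * (t - T1)) ^ 2 := by
      rw [← Real.exp_nat_mul]
      congr 1
      push_cast
      ring
    have hb : e t ⬝ᵥ e t ≤ L0 / lam * Real.exp (-c * (t - T1)) ^ 2 := by
      rw [← hexp, div_mul_eq_mul_div, le_div_iff₀ hpmin]
      linarith
    rw [pi_norm_le_iff_of_nonneg (by positivity)]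
    intro i
    have hi : e t i ^ 2 ≤ e t ⬝ᵥ e t := by
      rw [sq]
      exact Finset.single_le_sum (f := fun i => e t i * e t i)
        (fun i _ => mul_self_nonneg _) (Finset.mem_univ i)
    rw [Real.norm_eq_abs]
    have h1 := Real.abs_le_sqrt (hi.trans hb)
    rwa [Real.sqrt_mul' _ (sq_nonneg _), Real.sqrt_sq (Real.exp_pos _).le] at h1
  · intro t ht
    have hsol : ∀ i j, θhat t i j - Θ i j =
        (θhat T1 i j - Θ i j) * Real.exp (-γ0 * (t - T1)) := by
      intro i j
      apply le_antisymm
      · exact decay (L := fun s => θhat s i j - Θ i j)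
          (fun s hs => (hθhat s hs i j).sub_const _) (fun s _ => le_rfl) t ht
      · have := decay (L := fun s => -(θhat s i j - Θ i j)) (k := γ0)
          (fun s hs => ((hθhat s hs i j).sub_const _).neg) (fun s _ => le_of_eq (by ring)) t ht
        linarith
    set E := Real.exp (-γ0 * (t - T1)) with hE
    have hs : 0 ≤ t - T1 := sub_nonneg.2 ht
    have hE0 : 0 < E := Real.exp_pos _
    have hE1 : E ≤ 1 := Real.exp_le_one_iff.2 (by nlinarith)
    have hE2 : E ≤ Real.exp (-(γ0 / 2) * (t - T1)) := Real.exp_le_exp.2 (by nlinarith)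
    have heq : θhat t - θ = E • (θhat T1 - θ) - (1 - E) • (V2 * V2ᵀ * θ) := by
      ext i j
      have h1 := hsol i j
      have h2 : Θ i j = θ i j - (V2 * V2ᵀ * θ) i j := by rw [hΘ]; rfl
      rw [h2] at h1
      simp only [Matrix.sub_apply, Matrix.smul_apply, smul_eq_mul]
      linarith
    rw [heq]
    refine (frob_sub_le E (1 - E) hE0.le (by linarith) _ _).trans ?_
    have hn0 : 0 ≤ frobNorm (θhat T1 - θ) := Real.sqrt_nonneg _
    have hn1 : 0 ≤ frobNorm (V2 * V2ᵀ * θ) := Real.sqrt_nonneg _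
    have hpj := frob_proj V2 hV2 θ
    have b1 := mul_le_mul_of_nonneg_right hE2 hn0
    have b2 := mul_nonneg hE0.le hn1
    linarith
end

section
/- (Corollary 1) Let k0 > 0, t0 ∈ ℝ, let φ̄ : [t0,∞) → ℝ^n be continuous and bounded, and define the filtered extended regressor φ(t) = ∫_{t0}^{t} e^{−k0(t−s)}·φ̄(s)·φ̄(s)ᵀ ds ∈ ℝ^{n×n}. Then φ̄ is persistently exciting — i.e., there exist T > 0 and α > 0 such that for all t ≥ t0 the smallest eigenvalue of ∫_{t}^{t+T} φ̄(τ)·φ̄(τ)ᵀ dτ is at least α — if and only if there exist T > 0, a positive integer k, and μ > 0 such that for all t ≥ t0 + kT the smallest eigenvalue of φ(t) exceeds μ. -/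
open Matrix

theorem aux_cont (n : ℕ) (t0 a b : ℝ) (φbar : ℝ → Fin n → ℝ)
    (hc : ContinuousOn φbar (Set.Ici t0)) (ha : t0 ≤ a) (hab : a ≤ b) (i : Fin n) :
    ContinuousOn (fun s => φbar s i) (Set.uIcc a b) := by
  have h1 : ContinuousOn φbar (Set.uIcc a b) := by
    apply hc.mono
    rw [Set.uIcc_of_le hab]
    intro s hs
    exact ha.trans hs.1
  exact (continuous_apply i).comp_continuousOn h1

theorem aux_int (n : ℕ) (t0 a b : ℝ) (φbar : ℝ → Fin n → ℝ)
    (hc : ContinuousOn φbar (Set.Ici t0)) (ha : t0 ≤ a) (hab : a ≤ b)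
    (w : ℝ → ℝ) (hw : Continuous w) (x : Fin n → ℝ) :
    IntervalIntegrable (fun s => w s * (x ⬝ᵥ φbar s) ^ 2) MeasureTheory.volume a b := by
  apply ContinuousOn.intervalIntegrable
  apply hw.continuousOn.mul
  apply ContinuousOn.pow
  unfold dotProduct
  apply continuousOn_finsetSum
  intro i _
  exact continuousOn_const.mul (aux_cont n t0 a b φbar hc ha hab i)

theorem aux_quad_s15 (n : ℕ) (t0 a b : ℝ) (φbar : ℝ → Fin n → ℝ)
    (hc : ContinuousOn φbar (Set.Ici t0)) (ha : t0 ≤ a) (hab : a ≤ b)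
    (w : ℝ → ℝ) (hw : Continuous w) (x : Fin n → ℝ)
    (M : Matrix (Fin n) (Fin n) ℝ)
    (hM : ∀ i j, M i j = ∫ s in a..b, w s * (φbar s i * φbar s j)) :
    x ⬝ᵥ M.mulVec x = ∫ s in a..b, w s * (x ⬝ᵥ φbar s) ^ 2 := by
  have hI : ∀ i j, IntervalIntegrable (fun s => x i * x j * (w s * (φbar s i * φbar s j)))
      MeasureTheory.volume a b := by
    intro i j
    apply ContinuousOn.intervalIntegrable
    exact continuousOn_const.mul (hw.continuousOn.mul
      ((aux_cont n t0 a b φbar hc ha hab i).mul (aux_cont n t0 a b φbar hc ha hab j)))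
  have e : ∀ s, w s * (x ⬝ᵥ φbar s) ^ 2 =
      ∑ i, ∑ j, x i * x j * (w s * (φbar s i * φbar s j)) := by
    intro s
    rw [sq]
    unfold dotProduct
    rw [Finset.sum_mul_sum, Finset.mul_sum]
    refine Finset.sum_congr rfl fun i _ => ?_
    rw [Finset.mul_sum]
    refine Finset.sum_congr rfl fun j _ => ?_
    ring
  simp_rw [e]
  rw [intervalIntegral.integral_finsetSum]
  · unfold dotProduct mulVec dotProduct
    refine Finset.sum_congr rfl fun i _ => ?_
    rw [intervalIntegral.integral_finsetSum (fun j _ => hI i j), Finset.mul_sum]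
    refine Finset.sum_congr rfl fun j _ => ?_
    rw [intervalIntegral.integral_const_mul, ← hM]
    show x i * (M i j * x j) = _
    ring
  · intro i _
    apply ContinuousOn.intervalIntegrable
    apply continuousOn_finsetSum
    intro j _
    exact continuousOn_const.mul (hw.continuousOn.mul
      ((aux_cont n t0 a b φbar hc ha hab i).mul (aux_cont n t0 a b φbar hc ha hab j)))

theorem aux_bound (n : ℕ) (C : ℝ) (v x : Fin n → ℝ) (hv : ‖v‖ ≤ C) :
    (x ⬝ᵥ v) ^ 2 ≤ (n * C ^ 2) * (x ⬝ᵥ x) := by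
  have h1 := Finset.sum_mul_sq_le_sq_mul_sq Finset.univ x v
  have h2 : ∑ i, v i ^ 2 ≤ n * C ^ 2 := by
    calc ∑ i, v i ^ 2 ≤ ∑ i : Fin n, C ^ 2 := by
          refine Finset.sum_le_sum fun i _ => ?_
          have := (norm_le_pi_norm v i).trans hv
          rw [Real.norm_eq_abs] at this
          exact sq_le_sq' (abs_le.1 this).1 (abs_le.1 this).2
      _ = n * C ^ 2 := by simp
  have h3 : x ⬝ᵥ x = ∑ i, x i ^ 2 := by
    unfold dotProduct
    exact Finset.sum_congr rfl fun i _ => (sq _).symm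
  rw [h3]
  have h4 : 0 ≤ ∑ i, x i ^ 2 := Finset.sum_nonneg fun i _ => sq_nonneg _
  unfold dotProduct
  nlinarith

theorem aux_exp (k0 a b t : ℝ) (hk0 : 0 < k0) :
    ∫ s in a..b, Real.exp (-k0 * (t - s)) =
      Real.exp (-k0 * (t - b)) / k0 - Real.exp (-k0 * (t - a)) / k0 := by
  apply intervalIntegral.integral_eq_sub_of_hasDerivAt (f := fun s => Real.exp (-k0 * (t - s)) / k0)
  · intro s _
    have h : HasDerivAt (fun s => -k0 * (t - s)) (-k0 * (-1)) s :=
      ((hasDerivAt_id s).const_sub t).const_mul (-k0)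
    refine (h.exp.div_const k0).congr_deriv ?_
    rw [div_eq_iff hk0.ne']
    ring
  · exact Continuous.intervalIntegrable (by fun_prop) _ _

/-- Corollary 1: a bounded continuous regressor `φ̄` is persistently exciting
(`λ_min(∫_t^{t+T} φ̄ φ̄ᵀ) ≥ α` for all `t ≥ t0`; equivalently the quadratic
form is bounded below by `α ‖x‖²`) iff the smallest eigenvalue of the filtered
extended regressor `φ(t) = ∫_{t0}^t e^{−k0(t−s)} φ̄(s) φ̄(s)ᵀ ds` exceeds some
`μ > 0` for all `t ≥ t0 + kT`. -/
theorem corollary1_PE_iff_filtered_lower_bound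
    (n : ℕ) (t0 k0 : ℝ) (hk0 : 0 < k0)
    (φbar : ℝ → Fin n → ℝ)
    (hc : ContinuousOn φbar (Set.Ici t0))
    (hb : ∃ Cb, ∀ t, t0 ≤ t → ‖φbar t‖ ≤ Cb)
    (φ : ℝ → Matrix (Fin n) (Fin n) ℝ)
    (hφ : ∀ t i j, φ t i j =
      ∫ s in t0..t, Real.exp (-k0 * (t - s)) * (φbar s i * φbar s j)) :
    (∃ T > (0 : ℝ), ∃ α > (0 : ℝ), ∀ t, t0 ≤ t → ∀ x : Fin n → ℝ,
        α * (x ⬝ᵥ x) ≤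
          x ⬝ᵥ (Matrix.of fun i j =>
            ∫ τ in t..t + T, φbar τ i * φbar τ j).mulVec x) ↔
    (∃ T > (0 : ℝ), ∃ k : ℕ, 0 < k ∧ ∃ μ > (0 : ℝ),
        ∀ t, t0 + k * T ≤ t → ∀ x : Fin n → ℝ, x ≠ 0 →
          μ * (x ⬝ᵥ x) < x ⬝ᵥ (φ t).mulVec x) := by
  have hw : ∀ t : ℝ, Continuous fun s => Real.exp (-k0 * (t - s)) := fun t => by fun_prop
  have hpos : ∀ x : Fin n → ℝ, x ≠ 0 → 0 < x ⬝ᵥ x := fun x hx => by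
    have h0 : 0 ≤ x ⬝ᵥ x := Finset.sum_nonneg fun i _ => mul_self_nonneg _
    exact lt_of_le_of_ne h0 fun h => hx (dotProduct_self_eq_zero.1 h.symm)
  have hQ : ∀ t, t0 ≤ t → ∀ x : Fin n → ℝ, x ⬝ᵥ (φ t).mulVec x =
      ∫ s in t0..t, Real.exp (-k0 * (t - s)) * (x ⬝ᵥ φbar s) ^ 2 := fun t ht x =>
    aux_quad_s15 n t0 t0 t φbar hc le_rfl ht _ (hw t) x (φ t) (hφ t)
  have hP : ∀ t T, t0 ≤ t → 0 < T → ∀ x : Fin n → ℝ,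
      x ⬝ᵥ (Matrix.of fun i j => ∫ τ in t..t + T, φbar τ i * φbar τ j).mulVec x =
      ∫ s in t..t + T, 1 * (x ⬝ᵥ φbar s) ^ 2 := fun t T ht hT x =>
    aux_quad_s15 n t0 t (t + T) φbar hc ht (by linarith) (fun _ => 1) continuous_const x _
      (fun i j => by simp)
  constructor
  · rintro ⟨T, hT, α, hα, H⟩
    refine ⟨T, hT, 1, one_pos, Real.exp (-k0 * T) * α / 2, by positivity, ?_⟩
    intro t ht x hx
    have ht : t0 + T ≤ t := by simpa using ht
    have hxx := hpos x hx
    have H1 := H (t - T) (by linarith) x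
    rw [hP (t - T) T (by linarith) hT x, sub_add_cancel] at H1
    rw [hQ t (by linarith) x,
      ← intervalIntegral.integral_add_adjacent_intervals (b := t - T)
        (aux_int n t0 t0 (t - T) φbar hc le_rfl (by linarith) _ (hw t) x)
        (aux_int n t0 (t - T) t φbar hc (by linarith) (by linarith) _ (hw t) x)]
    have h1 : 0 ≤ ∫ s in t0..(t - T), Real.exp (-k0 * (t - s)) * (x ⬝ᵥ φbar s) ^ 2 :=
      intervalIntegral.integral_nonneg (by linarith) fun s _ => by positivity
    have h2 : Real.exp (-k0 * T) * (∫ s in (t - T)..t, 1 * (x ⬝ᵥ φbar s) ^ 2) ≤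
        ∫ s in (t - T)..t, Real.exp (-k0 * (t - s)) * (x ⬝ᵥ φbar s) ^ 2 := by
      rw [← intervalIntegral.integral_const_mul]
      apply intervalIntegral.integral_mono_on (by linarith)
      · exact (aux_int n t0 (t - T) t φbar hc (by linarith) (by linarith) _
          continuous_const x).const_mul _
      · exact aux_int n t0 (t - T) t φbar hc (by linarith) (by linarith) _ (hw t) x
      · intro s hs
        rw [one_mul]
        apply mul_le_mul_of_nonneg_right _ (sq_nonneg _)
        apply Real.exp_le_exp.2
        nlinarith [hs.1]
    have h3 := mul_le_mul_of_nonneg_left H1 (Real.exp_pos (-k0 * T)).le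
    have h4 : 0 < Real.exp (-k0 * T) * α * (x ⬝ᵥ x) := by positivity
    linarith
  · rintro ⟨T, hT, k, hk, μ, hμ, H⟩
    obtain ⟨Cb, hCb⟩ := hb
    obtain ⟨C, hC⟩ : ∃ C : ℝ, C = n * Cb ^ 2 := ⟨_, rfl⟩
    have hC0 : 0 ≤ C := by rw [hC]; positivity
    obtain ⟨S, hS⟩ : ∃ S : ℝ, S = k * T + 2 * C / (k0 ^ 2 * μ) := ⟨_, rfl⟩
    have hk' : (0 : ℝ) < k := by exact_mod_cast hk
    have hkT : 0 < k * T := by positivity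
    have hS2 : 0 ≤ 2 * C / (k0 ^ 2 * μ) := by positivity
    have hSpos : 0 < S := by linarith
    have hE : C / k0 * Real.exp (-k0 * S) ≤ μ / 2 := by
      have e1 : C / k0 ≤ μ / 2 * (k0 * S) := by
        have : C / k0 = μ / 2 * (k0 * (2 * C / (k0 ^ 2 * μ))) := by field_simp
        rw [this]
        gcongr
        linarith
      have e2 := Real.add_one_le_exp (k0 * S)
      have e3 : C / k0 ≤ μ / 2 * Real.exp (k0 * S) :=
        e1.trans (by gcongr; linarith)
      calc C / k0 * Real.exp (-k0 * S)
          ≤ μ / 2 * Real.exp (k0 * S) * Real.exp (-k0 * S) := by gcongr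
        _ = μ / 2 := by rw [mul_assoc, ← Real.exp_add]; simp
    refine ⟨S, hSpos, μ / 2, by positivity, ?_⟩
    intro t ht x
    rw [hP t S ht hSpos x]
    by_cases hx : x = 0
    · subst hx
      simp
    have hxx := hpos x hx
    have H1 := H (t + S) (by linarith) x hx
    rw [hQ (t + S) (by linarith) x,
      ← intervalIntegral.integral_add_adjacent_intervals (b := t)
        (aux_int n t0 t0 t φbar hc le_rfl ht _ (hw (t + S)) x)
        (aux_int n t0 t (t + S) φbar hc ht (by linarith) _ (hw (t + S)) x)] at H1
    have h1 : ∫ s in t0..t, Real.exp (-k0 * (t + S - s)) * (x ⬝ᵥ φbar s) ^ 2 ≤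
        ∫ s in t0..t, Real.exp (-k0 * (t + S - s)) * (C * (x ⬝ᵥ x)) := by
      apply intervalIntegral.integral_mono_on ht
      · exact aux_int n t0 t0 t φbar hc le_rfl ht _ (hw (t + S)) x
      · exact Continuous.intervalIntegrable (by fun_prop) _ _
      · intro s hs
        rw [hC]
        exact mul_le_mul_of_nonneg_left (aux_bound n Cb _ x (hCb s hs.1)) (Real.exp_pos _).le
    rw [intervalIntegral.integral_mul_const, aux_exp k0 t0 t (t + S) hk0,
      add_sub_cancel_left] at h1
    have h2 : ∫ s in t..t + S, Real.exp (-k0 * (t + S - s)) * (x ⬝ᵥ φbar s) ^ 2 ≤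
        ∫ s in t..t + S, 1 * (x ⬝ᵥ φbar s) ^ 2 := by
      apply intervalIntegral.integral_mono_on (by linarith)
      · exact aux_int n t0 t (t + S) φbar hc ht (by linarith) _ (hw (t + S)) x
      · exact aux_int n t0 t (t + S) φbar hc ht (by linarith) _ continuous_const x
      · intro s hs
        apply mul_le_mul_of_nonneg_right _ (sq_nonneg _)
        apply Real.exp_le_one_iff.2
        nlinarith [hs.2]
    have h3 : (Real.exp (-k0 * S) / k0 - Real.exp (-k0 * (t + S - t0)) / k0) * (C * (x ⬝ᵥ x)) ≤
        μ / 2 * (x ⬝ᵥ x) := by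
      calc _ ≤ (Real.exp (-k0 * S) / k0) * (C * (x ⬝ᵥ x)) := by
            gcongr
            have : 0 ≤ Real.exp (-k0 * (t + S - t0)) / k0 := by positivity
            linarith
        _ = (C / k0 * Real.exp (-k0 * S)) * (x ⬝ᵥ x) := by ring
        _ ≤ _ := by gcongr
    linarith
end

section
/- (Corollary 2) Let k0 > 0, t0 ∈ ℝ, let φ̄ : [t0,∞) → ℝ^n be continuous and bounded, let 0 < r < n, and define the filtered extended regressor φ(t) = ∫_{t0}^{t} e^{−k0(t−s)}·φ̄(s)·φ̄(s)ᵀ ds ∈ ℝ^{n×n}. For a symmetric positive semidefinite matrix M, let λ_1(M) ≥ λ_2(M) ≥ … ≥ λ_n(M) denote its eigenvalues in decreasing order. Then φ̄ is semi-persistently exciting with rank r — i.e., there exist T > 0 and 0 < α_low ≤ α_up such that for all t ≥ t0 and all i ∈ {1,…,r}: α_low ≤ λ_i(∫_{t}^{t+T} φ̄(τ)·φ̄(τ)ᵀ dτ) ≤ α_up, while λ_i(∫_{t}^{t+T} φ̄(τ)·φ̄(τ)ᵀ dτ) = 0 for i > r — if and only if there exist T > 0, a positive integer k, and μ > 0 such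 that for all t ≥ t0 + kT and all i ∈ {1,…,r}: λ_i(φ(t)) > μ, while λ_i(φ(t)) = 0 for i > r. -/
open Matrix

/-- `EigProfile M r P` says that the (real symmetric) matrix `M` admits an
orthonormal eigendecomposition `M = V diag(f) Vᵀ` in which the first `r`
eigenvalues satisfy the predicate `P` and the remaining ones are zero; for a
symmetric matrix this expresses that, listing the eigenvalues in decreasing
order, the `r` leading eigenvalues satisfy `P` and the rest vanish. -/
def EigProfile {n : ℕ} (M : Matrix (Fin n) (Fin n) ℝ) (r : ℕ)
    (P : ℝ → Prop) : Prop :=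
  ∃ V : Matrix (Fin n) (Fin n) ℝ, Vᵀ * V = 1 ∧
    ∃ f : Fin n → ℝ, M = V * Matrix.diagonal f * Vᵀ ∧
      (∀ i : Fin n, (i : ℕ) < r → P (f i)) ∧
      (∀ i : Fin n, r ≤ (i : ℕ) → f i = 0)

theorem aux_nonneg {n : ℕ} (x : Fin n → ℝ) : 0 ≤ x ⬝ᵥ x :=
  Finset.sum_nonneg fun i _ => mul_self_nonneg (x i)

theorem aux_vvt {n : ℕ} {V : Matrix (Fin n) (Fin n) ℝ} (h : Vᵀ * V = 1) : V * Vᵀ = 1 :=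
  mul_eq_one_comm.mp h

theorem aux_rank {n r : ℕ} (hrn : r < n) {B : Matrix (Fin n) (Fin n) ℝ} {β : ℝ} (hβ : 0 < β)
    {P : ℝ → Prop} (hP : ∀ x, P x → β ≤ x) (h : EigProfile B r P) : B.rank = r := by
  obtain ⟨V, hV, f, rfl, h1, h2⟩ := h
  have hV' := aux_vvt hV
  have u1 : IsUnit V.det := (Matrix.isUnit_iff_isUnit_det V).mp ⟨⟨V, Vᵀ, hV', hV⟩, rfl⟩
  have u2 : IsUnit Vᵀ.det := by rwa [Matrix.det_transpose]
  rw [Matrix.rank_mul_eq_left_of_isUnit_det _ _ u2, Matrix.rank_mul_eq_right_of_isUnit_det _ _ u1,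
    Matrix.rank_diagonal]
  have hiff : ∀ i : Fin n, f i ≠ 0 ↔ (i : ℕ) < r := by
    intro i
    constructor
    · intro hi
      by_contra hc
      exact hi (h2 i (not_lt.mp hc))
    · intro hi
      have := hP _ (h1 i hi)
      linarith
  rw [Fintype.card_congr (Equiv.subtypeEquivRight hiff)]
  rw [Fintype.card_congr (Fin.castLEquiv hrn.le).symm, Fintype.card_fin]

theorem aux_lb {n r : ℕ} {B : Matrix (Fin n) (Fin n) ℝ} {β : ℝ} 
    {P : ℝ → Prop} (hP : ∀ x, P x → β ≤ x) (h : EigProfile B r P) (x : Fin n → ℝ) :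
    ∃ z, B *ᵥ (x - z) = 0 ∧ β * (z ⬝ᵥ z) ≤ z ⬝ᵥ (B *ᵥ z) := by
  obtain ⟨V, hV, f, rfl, h1, h2⟩ := h
  have hV' := aux_vvt hV
  let d : Fin n → ℝ := fun i => if (i : ℕ) < r then (Vᵀ *ᵥ x) i else 0
  refine ⟨V *ᵥ d, ?_, ?_⟩
  · rw [← Matrix.mulVec_mulVec, ← Matrix.mulVec_mulVec, Matrix.mulVec_sub, Matrix.mulVec_mulVec d,
      hV, Matrix.one_mulVec]
    have : Matrix.diagonal f *ᵥ (Vᵀ *ᵥ x - d) = 0 := by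
      ext i
      rw [Matrix.mulVec_diagonal]
      by_cases hi : (i : ℕ) < r
      · simp [d, hi]
      · simp [h2 i (not_lt.mp hi)]
    rw [this, Matrix.mulVec_zero]
  · have e : ∀ y : Fin n → ℝ, (V *ᵥ d) ⬝ᵥ (V *ᵥ y) = d ⬝ᵥ y := by
      intro y
      rw [Matrix.dotProduct_mulVec, Matrix.vecMul_mulVec, hV, Matrix.vecMul_one]
    rw [← Matrix.mulVec_mulVec, ← Matrix.mulVec_mulVec, Matrix.mulVec_mulVec d,
      hV, Matrix.one_mulVec, e, e]
    simp only [dotProduct, Finset.mul_sum, Matrix.mulVec_diagonal]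
    apply Finset.sum_le_sum
    intro i _
    by_cases hi : (i : ℕ) < r
    · have := hP _ (h1 i hi)
      nlinarith [mul_self_nonneg (d i)]
    · simp [d, hi]

theorem aux_build {n r : ℕ} (hrn : r < n) {A : Matrix (Fin n) (Fin n) ℝ} (hA : A.IsHermitian)
    (hr : A.rank = r) {P : ℝ → Prop}
    (h : ∀ (l : ℝ) (v : Fin n → ℝ), l ≠ 0 → v ⬝ᵥ v = 1 → A *ᵥ v = l • v → P l) :
    EigProfile A r P := by
  have hev : ∀ i, hA.eigenvalues i ≠ 0 → P (hA.eigenvalues i) := by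
    intro i hi
    refine h _ (hA.eigenvectorBasis i) hi ?_ (hA.mulVec_eigenvectorBasis i)
    have := hA.eigenvectorBasis.orthonormal.1 i
    have h2 : inner ℝ (hA.eigenvectorBasis i) (hA.eigenvectorBasis i) = (1:ℝ) := by
      rw [real_inner_self_eq_norm_sq, this]; norm_num
    rw [EuclideanSpace.inner_eq_star_dotProduct] at h2
    simpa only [star_trivial] using h2
  have hcard : Fintype.card {i : Fin n // (i : ℕ) < r} = Fintype.card {i // hA.eigenvalues i ≠ 0} := by
    rw [← hA.rank_eq_card_non_zero_eigs, hr, Fintype.card_congr (Fin.castLEquiv hrn.le).symm,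
      Fintype.card_fin]
  let e0 := Fintype.equivOfCardEq hcard
  let e : Equiv.Perm (Fin n) := e0.extendSubtype
  let U : Matrix (Fin n) (Fin n) ℝ := hA.eigenvectorUnitary
  have hU : Uᵀ * U = 1 := by
    have := Unitary.coe_star_mul_self hA.eigenvectorUnitary
    simpa [Matrix.star_eq_conjTranspose] using this
  refine ⟨U.submatrix id e, ?_, hA.eigenvalues ∘ e, ?_, ?_, ?_⟩
  · rw [Matrix.transpose_submatrix, ← Matrix.submatrix_mul _ _ _ _ _ Function.bijective_id, hU]
    exact Matrix.submatrix_one_equiv e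
  · have hs := hA.spectral_theorem
    rw [Unitary.conjStarAlgAut_apply] at hs
    have hs' : A = U * Matrix.diagonal hA.eigenvalues * Uᵀ := by
      simpa [Matrix.star_eq_conjTranspose] using hs
    conv_lhs => rw [hs']
    ext i j
    rw [Matrix.mul_apply, Matrix.mul_apply]
    simp only [Matrix.mul_diagonal, Matrix.transpose_apply, Matrix.submatrix_apply,
      id, Function.comp]
    exact (Equiv.sum_comp e (fun k => U i k * hA.eigenvalues k * U j k)).symm
  · intro i hi
    exact hev _ (e0.extendSubtype_mem i hi)
  · intro i hi
    exact not_not.mp (e0.extendSubtype_not_mem i (not_lt.mpr hi))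

theorem aux_ker {n r : ℕ} {A B : Matrix (Fin n) (Fin n) ℝ} {β c δ : ℝ}
    {P : ℝ → Prop} (hP : ∀ x, P x → β ≤ x) (h : EigProfile B r P) (hc : 0 ≤ c) (hδ : δ < c * β)
    (hBA : ∀ x, B *ᵥ x = 0 → A *ᵥ x = 0)
    (hq : ∀ x, c * (x ⬝ᵥ (B *ᵥ x)) - δ * (x ⬝ᵥ x) ≤ x ⬝ᵥ (A *ᵥ x))
    (x : Fin n → ℝ) (hx : A *ᵥ x = 0) : B *ᵥ x = 0 := by
  obtain ⟨z, hz, hz2⟩ := aux_lb hP h x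
  have h1 := hBA _ hz
  rw [Matrix.mulVec_sub, hx, zero_sub, neg_eq_zero] at h1
  have h2 := hq z
  rw [h1, dotProduct_zero] at h2
  have h0 : 0 ≤ z ⬝ᵥ z := aux_nonneg z
  have h3 : z ⬝ᵥ z = 0 := by nlinarith
  rw [dotProduct_self_eq_zero] at h3
  simpa [h3] using hz

theorem aux_main {n r : ℕ} (hrn : r < n) {A B : Matrix (Fin n) (Fin n) ℝ} {β c δ : ℝ}
    (hβ : 0 < β)
    {P Q : ℝ → Prop} (hP : ∀ x, P x → β ≤ x) (h : EigProfile B r P) (hc : 0 ≤ c) (hδ : δ < c * β)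
    (hBA : ∀ x, B *ᵥ x = 0 → A *ᵥ x = 0)
    (hq : ∀ x, c * (x ⬝ᵥ (B *ᵥ x)) - δ * (x ⬝ᵥ x) ≤ x ⬝ᵥ (A *ᵥ x))
    (hA : A.IsHermitian) {b : ℝ} (hub : ∀ x, x ⬝ᵥ (A *ᵥ x) ≤ b * (x ⬝ᵥ x))
    (hQ : ∀ l, c * β - δ ≤ l → l ≤ b → Q l) : EigProfile A r Q := by
  have hk := aux_ker hP h hc hδ hBA hq
  have hrB := aux_rank hrn hβ hP h
  have hkk : LinearMap.ker A.mulVecLin = LinearMap.ker B.mulVecLin := by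
    ext x
    simp only [LinearMap.mem_ker, Matrix.mulVecLin_apply]
    exact ⟨hk x, hBA x⟩
  have hrA : A.rank = r := by
    have e1 := LinearMap.finrank_range_add_finrank_ker A.mulVecLin
    have e2 := LinearMap.finrank_range_add_finrank_ker B.mulVecLin
    rw [hkk] at e1
    unfold Matrix.rank at hrB ⊢
    omega
  refine aux_build hrn hA hrA ?_
  intro l v hl hv hAv
  obtain ⟨z, hz, hz2⟩ := aux_lb hP h v
  have h1 := hBA _ hz
  have hAt : Aᵀ = A := by simpa using hA.eq
  have h2 : v ⬝ᵥ (v - z) = 0 := by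
    have : (A *ᵥ v) ⬝ᵥ (v - z) = 0 := by
      rw [← Matrix.vecMul_transpose, hAt, ← Matrix.dotProduct_mulVec, h1, dotProduct_zero]
    rw [hAv, smul_dotProduct, smul_eq_mul] at this
    exact (mul_eq_zero.mp this).resolve_left hl
  have h3 : 0 ≤ (v - z) ⬝ᵥ (v - z) := aux_nonneg _
  simp only [dotProduct_sub, sub_dotProduct] at h2 h3
  have hcm := dotProduct_comm v z
  have h4 : 1 ≤ z ⬝ᵥ z := by linarith
  have h5 := hq v
  have h6 := hub v
  have h7 : v ⬝ᵥ (A *ᵥ v) = l := by rw [hAv, dotProduct_smul, hv]; simp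
  -- B v = B z and v ⬝ B v ≥ z ⬝ B z
  have hAz : A *ᵥ z = A *ᵥ v := by
    rw [Matrix.mulVec_sub, sub_eq_zero] at h1; exact h1.symm
  have h8 := hq z
  have h9 : z ⬝ᵥ (A *ᵥ z) = l := by
    rw [hAz, hAv, dotProduct_smul, smul_eq_mul]
    have : z ⬝ᵥ v = 1 := by linarith
    rw [this, mul_one]
  rw [h7, hv] at h6
  apply hQ _ _ (by linarith)
  rw [h9] at h8
  nlinarith [mul_le_mul_of_nonneg_left hz2 hc]

/-- weighted Gramian -/
noncomputable def auxW {n : ℕ} (g : ℝ → Fin n → ℝ) (w : ℝ → ℝ) (a b : ℝ) :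
    Matrix (Fin n) (Fin n) ℝ :=
  Matrix.of fun i j => ∫ s in a..b, w s * (g s i * g s j)

theorem auxW_herm {n : ℕ} (g : ℝ → Fin n → ℝ) (w : ℝ → ℝ) (a b : ℝ) :
    (auxW g w a b).IsHermitian := by
  ext i j
  simp [auxW, mul_comm]

theorem auxW_mulVec {n : ℕ} {g : ℝ → Fin n → ℝ} (hg : Continuous g) {w : ℝ → ℝ}
    (hw : Continuous w) (a b : ℝ) (x : Fin n → ℝ) (i : Fin n) :
    (auxW g w a b *ᵥ x) i = ∫ s in a..b, w s * (g s i * (g s ⬝ᵥ x)) := by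
  have hgi : ∀ i, Continuous fun s => g s i := fun i => (continuous_apply i).comp hg
  simp only [Matrix.mulVec, dotProduct, auxW, Matrix.of_apply]
  simp_rw [← intervalIntegral.integral_mul_const]
  rw [← intervalIntegral.integral_finsetSum]
  · congr 1
    ext s
    rw [Finset.mul_sum, Finset.mul_sum]
    refine Finset.sum_congr rfl fun j _ => by ring
  · intro j _
    have := hgi i
    have := hgi j
    exact Continuous.intervalIntegrable (by fun_prop) _ _

theorem auxW_quad {n : ℕ} {g : ℝ → Fin n → ℝ} (hg : Continuous g) {w : ℝ → ℝ}
    (hw : Continuous w) (a b : ℝ) (x : Fin n → ℝ) :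
    x ⬝ᵥ (auxW g w a b *ᵥ x) = ∫ s in a..b, w s * (g s ⬝ᵥ x) ^ 2 := by
  have hgi : ∀ i, Continuous fun s => g s i := fun i => (continuous_apply i).comp hg
  have hgx : Continuous fun s => g s ⬝ᵥ x := hg.dotProduct continuous_const
  rw [dotProduct]
  simp_rw [auxW_mulVec hg hw, ← intervalIntegral.integral_const_mul]
  rw [← intervalIntegral.integral_finsetSum]
  · congr 1
    ext s
    rw [pow_two]
    conv_rhs => rw [← mul_assoc, dotProduct, Finset.mul_sum]
    refine Finset.sum_congr rfl fun j _ => by rw [dotProduct]; ring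
  · intro j _
    have := hgi j
    exact Continuous.intervalIntegrable (by fun_prop) _ _

theorem auxW_zero {n : ℕ} {g : ℝ → Fin n → ℝ} (hg : Continuous g) {w : ℝ → ℝ}
    (hw : Continuous w) {a b : ℝ} (hab : a ≤ b) (x : Fin n → ℝ)
    (h : ∀ s ∈ Set.Icc a b, g s ⬝ᵥ x = 0) : auxW g w a b *ᵥ x = 0 := by
  ext i
  rw [auxW_mulVec hg hw]
  apply intervalIntegral.integral_zero_ae
  refine Filter.Eventually.of_forall fun s hs => ?_
  rw [Set.uIoc_of_le hab] at hs
  rw [h s ⟨hs.1.le, hs.2⟩]; ring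

theorem auxW_of_zero {n : ℕ} {g : ℝ → Fin n → ℝ} (hg : Continuous g) {w : ℝ → ℝ}
    (hw : Continuous w) (hpos : ∀ s, 0 < w s) {a b : ℝ} (hab : a < b) (x : Fin n → ℝ)
    (h : auxW g w a b *ᵥ x = 0) : ∀ s ∈ Set.Icc a b, g s ⬝ᵥ x = 0 := by
  have hgx : Continuous fun s => g s ⬝ᵥ x := hg.dotProduct continuous_const
  by_contra hc
  push Not at hc
  obtain ⟨s, hs, hne⟩ := hc
  have h1 := auxW_quad hg hw a b x
  rw [h, dotProduct_zero] at h1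
  have : 0 < ∫ s in a..b, w s * (g s ⬝ᵥ x) ^ 2 := by
    apply intervalIntegral.integral_pos hab (by fun_prop)
    · intro u _
      have := hpos u
      positivity
    · refine ⟨s, hs, ?_⟩
      have := hpos s
      positivity
  linarith

theorem auxW_le {n : ℕ} {g : ℝ → Fin n → ℝ} (hg : Continuous g) {w : ℝ → ℝ}
    (hw : Continuous w) (hpos : ∀ s, 0 < w s) {D : ℝ}
    (hD : ∀ s x, (g s ⬝ᵥ x) ^ 2 ≤ D * (x ⬝ᵥ x)) {a b : ℝ} (hab : a ≤ b) (x : Fin n → ℝ) :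
    x ⬝ᵥ (auxW g w a b *ᵥ x) ≤ (∫ s in a..b, w s) * D * (x ⬝ᵥ x) := by
  have hgx : Continuous fun s => g s ⬝ᵥ x := hg.dotProduct continuous_const
  rw [auxW_quad hg hw, mul_assoc, ← intervalIntegral.integral_mul_const]
  apply intervalIntegral.integral_mono_on hab
  · exact Continuous.intervalIntegrable (by fun_prop) _ _
  · exact Continuous.intervalIntegrable (by fun_prop) _ _
  · intro s _
    exact mul_le_mul_of_nonneg_left (hD s x) (hpos s).le

theorem auxW_add {n : ℕ} {g : ℝ → Fin n → ℝ} (hg : Continuous g) {w : ℝ → ℝ}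
    (hw : Continuous w) (a b c : ℝ) (x : Fin n → ℝ) :
    x ⬝ᵥ (auxW g w a c *ᵥ x) =
      x ⬝ᵥ (auxW g w a b *ᵥ x) + x ⬝ᵥ (auxW g w b c *ᵥ x) := by
  have hgx : Continuous fun s => g s ⬝ᵥ x := hg.dotProduct continuous_const
  simp only [auxW_quad hg hw]
  refine (intervalIntegral.integral_add_adjacent_intervals ?_ ?_).symm <;>
  exact Continuous.intervalIntegrable (by fun_prop) _ _

theorem auxW_nonneg {n : ℕ} {g : ℝ → Fin n → ℝ} (hg : Continuous g) {w : ℝ → ℝ}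
    (hw : Continuous w) (hpos : ∀ s, 0 < w s) {a b : ℝ} (hab : a ≤ b) (x : Fin n → ℝ) :
    0 ≤ x ⬝ᵥ (auxW g w a b *ᵥ x) := by
  rw [auxW_quad hg hw]
  apply intervalIntegral.integral_nonneg hab
  intro u _
  have := hpos u
  positivity

theorem auxW_comp {n : ℕ} {g : ℝ → Fin n → ℝ} (hg : Continuous g) {w w' : ℝ → ℝ}
    (hw : Continuous w) (hw' : Continuous w') {a b c : ℝ} (hab : a ≤ b)
    (h : ∀ s ∈ Set.Icc a b, c * w s ≤ w' s) (x : Fin n → ℝ) :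
    c * (x ⬝ᵥ (auxW g w a b *ᵥ x)) ≤ x ⬝ᵥ (auxW g w' a b *ᵥ x) := by
  have hgx : Continuous fun s => g s ⬝ᵥ x := hg.dotProduct continuous_const
  rw [auxW_quad hg hw, auxW_quad hg hw', ← intervalIntegral.integral_const_mul]
  apply intervalIntegral.integral_mono_on hab
  · exact Continuous.intervalIntegrable (by fun_prop) _ _
  · exact Continuous.intervalIntegrable (by fun_prop) _ _
  · intro s hs
    rw [← mul_assoc]
    exact mul_le_mul_of_nonneg_right (h s hs) (sq_nonneg _)

theorem aux_forward {n r : ℕ} (hrn : r < n) {t0 k0 : ℝ} (hk0 : 0 < k0)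
    {g : ℝ → Fin n → ℝ} (hg : Continuous g) {D : ℝ} (hD0 : 0 < D)
    (hD : ∀ s x, (g s ⬝ᵥ x) ^ 2 ≤ D * (x ⬝ᵥ x)) {T αlow αup : ℝ} (hT : 0 < T)
    (hα : 0 < αlow)
    (H : ∀ t, t0 ≤ t → EigProfile (auxW g (fun _ => 1) t (t + T)) r
      (fun x => αlow ≤ x ∧ x ≤ αup)) :
    ∃ μ > (0 : ℝ), ∀ t, t0 + T ≤ t →
      EigProfile (auxW g (fun s => Real.exp (-k0 * (t - s))) t0 t) r (fun x => μ < x) := by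
  have h1c : Continuous (fun _ : ℝ => (1:ℝ)) := continuous_const
  have h1p : ∀ s : ℝ, (0:ℝ) < (fun _ : ℝ => (1:ℝ)) s := fun _ => one_pos
  have hP : ∀ x, (αlow ≤ x ∧ x ≤ αup) → αlow ≤ x := fun x h => h.1
  -- one step
  have step : ∀ t e, t0 ≤ t → 0 < e → e < T → e * D < αlow → ∀ x,
      auxW g (fun _ => 1) t (t + T) *ᵥ x = 0 → auxW g (fun _ => 1) (t + e) (t + e + T) *ᵥ x = 0 := by
    intro t e ht he heT heD x hx
    have hz := auxW_of_zero hg h1c h1p (by linarith) x hx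
    refine aux_ker (A := auxW g (fun _ => 1) (t + e) (t + T)) hP (H (t + e) (by linarith))
      (c := 1) (δ := e * D) zero_le_one (by linarith) ?_ ?_ x ?_
    · intro y hy
      have hz := auxW_of_zero hg h1c h1p (by linarith) y hy
      exact auxW_zero hg h1c (by linarith) y fun s hs => hz s ⟨hs.1, by linarith [hs.2]⟩
    · intro y
      have e1 := auxW_add hg h1c (t + e) (t + T) (t + e + T) y
      have e2 := auxW_le hg h1c h1p hD (a := t + T) (b := t + e + T) (by linarith) y
      simp only [intervalIntegral.integral_const, smul_eq_mul, mul_one] at e2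
      have : t + e + T - (t + T) = e := by ring
      rw [this] at e2
      linarith
    · exact auxW_zero hg h1c (by linarith) x fun s hs => hz s ⟨by linarith [hs.1], hs.2⟩
  have steps : ∀ e, 0 < e → e < T → e * D < αlow → ∀ (m : ℕ) t, t0 ≤ t → ∀ x,
      auxW g (fun _ => 1) t (t + T) *ᵥ x = 0 →
      auxW g (fun _ => 1) (t + m * e) (t + m * e + T) *ᵥ x = 0 := by
    intro e he heT heD m
    induction m with
    | zero => intro t ht x hx; simpa using hx
    | succ m ih =>
      intro t ht x hx
      have := step (t + m * e) e (by nlinarith [(Nat.cast_nonneg m : (0:ℝ) ≤ m)]) he heT heD x (ih t ht x hx)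
      have e1 : t + ((m + 1 : ℕ) : ℝ) * e = t + m * e + e := by push_cast; ring
      rw [e1]
      exact this
  have nxt : ∀ t s, t0 ≤ t → t < s → ∀ x,
      auxW g (fun _ => 1) t (t + T) *ᵥ x = 0 → auxW g (fun _ => 1) s (s + T) *ᵥ x = 0 := by
    intro t s ht hts x hx
    obtain ⟨m, hm⟩ := exists_nat_gt (max ((s - t) / T) ((s - t) * D / αlow))
    have hm1 := lt_of_le_of_lt (le_max_left _ _) hm
    have hm2 := lt_of_le_of_lt (le_max_right _ _) hm
    have hst : 0 < s - t := by linarith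
    have hm0 : (0:ℝ) < m := lt_trans (by positivity) hm1
    rw [div_lt_iff₀ hT] at hm1
    rw [div_lt_iff₀ hα] at hm2
    have := steps ((s - t) / m) (by positivity) (by rw [div_lt_iff₀ hm0]; linarith)
      (by rw [div_mul_eq_mul_div, div_lt_iff₀ hm0]; linarith) m t ht x hx
    have e1 : t + m * ((s - t) / m) = s := by field_simp; ring
    rwa [e1] at this
  -- kernel elements at time t annihilate all of the future
  have fut : ∀ x, auxW g (fun _ => 1) t0 (t0 + T) *ᵥ x = 0 → ∀ s, t0 ≤ s → g s ⬝ᵥ x = 0 := by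
    intro x hx s hs
    rcases hs.eq_or_lt with rfl | hs
    · exact auxW_of_zero hg h1c h1p (by linarith) x hx _ ⟨le_refl _, by linarith⟩
    · exact auxW_of_zero hg h1c h1p (by linarith) x (nxt t0 s le_rfl hs x hx) _
        ⟨le_refl _, by linarith⟩
  have back : ∀ t, t0 ≤ t → ∀ x, auxW g (fun _ => 1) t (t + T) *ᵥ x = 0 →
      auxW g (fun _ => 1) t0 (t0 + T) *ᵥ x = 0 := by
    intro t ht x hx
    have hle : LinearMap.ker (auxW g (fun _ => 1) t0 (t0 + T)).mulVecLin ≤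
        LinearMap.ker (auxW g (fun _ => 1) t (t + T)).mulVecLin := by
      intro y hy
      simp only [LinearMap.mem_ker, Matrix.mulVecLin_apply] at hy ⊢
      exact auxW_zero hg h1c (by linarith) y fun s hs => fut y hy s (by linarith [hs.1])
    have hfr : Module.finrank ℝ (LinearMap.ker (auxW g (fun _ => 1) t0 (t0 + T)).mulVecLin) =
        Module.finrank ℝ (LinearMap.ker (auxW g (fun _ => 1) t (t + T)).mulVecLin) := by
      have e1 := LinearMap.finrank_range_add_finrank_ker (auxW g (fun _ => 1) t0 (t0 + T)).mulVecLin
      have e2 := LinearMap.finrank_range_add_finrank_ker (auxW g (fun _ => 1) t (t + T)).mulVecLin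
      have r1 := aux_rank hrn hα hP (H t0 le_rfl)
      have r2 := aux_rank hrn hα hP (H t ht)
      unfold Matrix.rank at r1 r2
      omega
    have heq := Submodule.eq_of_le_of_finrank_eq hle hfr
    have : x ∈ LinearMap.ker (auxW g (fun _ => 1) t (t + T)).mulVecLin := by simpa using hx
    rw [← heq] at this
    simpa using this
  refine ⟨Real.exp (-k0 * T) * αlow / 2, by positivity, ?_⟩
  intro t ht
  have hwc : Continuous fun s => Real.exp (-k0 * (t - s)) := by fun_prop
  have hwp : ∀ s, 0 < Real.exp (-k0 * (t - s)) := fun s => Real.exp_pos _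
  have hpos : 0 < Real.exp (-k0 * T) * αlow := by positivity
  have Ht := H (t - T) (by linarith)
  refine aux_main hrn hα hP Ht (c := Real.exp (-k0 * T)) (δ := 0) (Real.exp_pos _).le hpos
    ?_ ?_ (auxW_herm _ _ _ _) (fun x => auxW_le hg hwc hwp hD (by linarith) x) ?_
  · intro x hx
    have h0 := fut x (back _ (by linarith) x hx)
    exact auxW_zero hg hwc (by linarith) x fun s hs => h0 s hs.1
  · intro x
    have e1 := auxW_add hg hwc t0 (t - T) t x
    have e2 := auxW_nonneg hg hwc hwp (a := t0) (b := t - T) (by linarith) x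
    have e3 := auxW_comp hg h1c hwc (a := t - T) (b := t) (c := Real.exp (-k0 * T)) (by linarith)
      (by
        intro s hs
        rw [mul_one]
        apply Real.exp_le_exp.mpr
        nlinarith [hs.1]) x
    rw [sub_add_cancel]
    linarith
  · intro l hl _
    linarith

theorem aux_expint {k0 : ℝ} (hk0 : 0 < k0) (a b c : ℝ) :
    ∫ s in a..b, Real.exp (-k0 * (c - s)) ≤ Real.exp (-k0 * (c - b)) / k0 := by
  have : ∀ s ∈ Set.uIcc a b, HasDerivAt (fun s => Real.exp (-k0 * (c - s)) / k0)
      (Real.exp (-k0 * (c - s))) s := by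
    intro s _
    have h1 : HasDerivAt (fun s => -k0 * (c - s)) (-k0 * (-1)) s :=
      ((hasDerivAt_id s).const_sub c).const_mul (-k0)
    have h2 := h1.exp.div_const k0
    have h3 : Real.exp (-k0 * (c - s)) * (-k0 * (-1)) / k0 = Real.exp (-k0 * (c - s)) := by
      field_simp
    rwa [h3] at h2
  rw [intervalIntegral.integral_eq_sub_of_hasDerivAt this
    (Continuous.intervalIntegrable (by fun_prop) _ _)]
  have : 0 < Real.exp (-k0 * (c - a)) / k0 := by positivity
  linarith

theorem aux_backward {n r : ℕ} (hrn : r < n) {t0 k0 : ℝ} (hk0 : 0 < k0)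
    {g : ℝ → Fin n → ℝ} (hg : Continuous g) {D : ℝ} (hD0 : 0 < D)
    (hD : ∀ s x, (g s ⬝ᵥ x) ^ 2 ≤ D * (x ⬝ᵥ x)) {T1 μ : ℝ} (hT1 : 0 < T1) (hμ : 0 < μ)
    (H : ∀ t, t0 + T1 ≤ t →
      EigProfile (auxW g (fun s => Real.exp (-k0 * (t - s))) t0 t) r (fun x => μ < x)) :
    ∃ T > (0 : ℝ), ∃ αlow αup : ℝ, 0 < αlow ∧ αlow ≤ αup ∧
        ∀ t, t0 ≤ t → EigProfile (auxW g (fun _ => 1) t (t + T)) r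
          (fun x => αlow ≤ x ∧ x ≤ αup) := by
  have h1c : Continuous (fun _ : ℝ => (1:ℝ)) := continuous_const
  have h1p : ∀ s : ℝ, (0:ℝ) < (fun _ : ℝ => (1:ℝ)) s := fun _ => one_pos
  have hP : ∀ x, μ < x → μ ≤ x := fun x h => h.le
  have hwc : ∀ t, Continuous fun s => Real.exp (-k0 * (t - s)) := fun t => by fun_prop
  have hwp : ∀ t s, 0 < Real.exp (-k0 * (t - s)) := fun t s => Real.exp_pos _
  -- kernels are constant
  have fut : ∀ t, t0 + T1 ≤ t → ∀ x,
      auxW g (fun s => Real.exp (-k0 * (t - s))) t0 t *ᵥ x = 0 → ∀ s, t0 ≤ s → g s ⬝ᵥ x = 0 := by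
    intro t ht x hx s hs
    have hu : t0 + T1 ≤ max t s := le_trans ht (le_max_left _ _)
    set u := max t s with hudef
    have htu : t ≤ u := le_max_left _ _
    have hle : LinearMap.ker (auxW g (fun s => Real.exp (-k0 * (u - s))) t0 u).mulVecLin ≤
        LinearMap.ker (auxW g (fun s => Real.exp (-k0 * (t - s))) t0 t).mulVecLin := by
      intro y hy
      simp only [LinearMap.mem_ker, Matrix.mulVecLin_apply] at hy ⊢
      have hz := auxW_of_zero hg (hwc u) (hwp u) (by linarith) y hy
      exact auxW_zero hg (hwc t) (by linarith) y fun s hs => hz s ⟨hs.1, hs.2.trans htu⟩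
    have hfr : Module.finrank ℝ
        (LinearMap.ker (auxW g (fun s => Real.exp (-k0 * (u - s))) t0 u).mulVecLin) =
        Module.finrank ℝ
        (LinearMap.ker (auxW g (fun s => Real.exp (-k0 * (t - s))) t0 t).mulVecLin) := by
      have e1 := LinearMap.finrank_range_add_finrank_ker
        (auxW g (fun s => Real.exp (-k0 * (u - s))) t0 u).mulVecLin
      have e2 := LinearMap.finrank_range_add_finrank_ker
        (auxW g (fun s => Real.exp (-k0 * (t - s))) t0 t).mulVecLin
      have r1 := aux_rank hrn hμ hP (H u hu)
      have r2 := aux_rank hrn hμ hP (H t ht)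
      unfold Matrix.rank at r1 r2
      omega
    have heq := Submodule.eq_of_le_of_finrank_eq hle hfr
    have hm : x ∈ LinearMap.ker
        (auxW g (fun s => Real.exp (-k0 * (t - s))) t0 t).mulVecLin := by simpa using hx
    rw [← heq] at hm
    exact auxW_of_zero hg (hwc u) (hwp u) (by linarith) x (by simpa using hm) s
      ⟨hs, le_max_right _ _⟩
  obtain ⟨T, hTT, hTδ⟩ : ∃ T, T1 ≤ T ∧ Real.exp (-k0 * T) / k0 * D < μ := by
    have h1 : Filter.Tendsto (fun T : ℝ => Real.exp (-k0 * T) / k0 * D) Filter.atTop (nhds 0) := by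
      have h2 : Filter.Tendsto (fun T : ℝ => Real.exp (-k0 * T)) Filter.atTop (nhds 0) := by
        apply Real.tendsto_exp_atBot.comp
        exact Filter.tendsto_id.const_mul_atTop_of_neg (by linarith)
      simpa using (h2.div_const k0).mul_const D
    obtain ⟨T, h3, h4⟩ := ((h1.eventually (gt_mem_nhds hμ)).and
      (Filter.eventually_ge_atTop T1)).exists
    exact ⟨T, h4, h3⟩
  set δ := Real.exp (-k0 * T) / k0 * D with hδ
  refine ⟨T, by linarith, μ - δ, max (μ - δ) (T * D), by linarith, le_max_left _ _, ?_⟩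
  intro t ht
  refine aux_main hrn hμ hP (H (t + T) (by linarith)) (c := 1) (δ := δ) zero_le_one (by linarith)
    ?_ ?_ (auxW_herm _ _ _ _) (b := T * D) ?_ ?_
  · intro x hx
    have hz := fut _ (by linarith) x hx
    exact auxW_zero hg h1c (by linarith) x fun s hs => hz s (ht.trans hs.1)
  · intro x
    have e1 := auxW_add hg (hwc (t + T)) t0 t (t + T) x
    have e2 := auxW_le hg (hwc (t + T)) (hwp _) hD (a := t0) (b := t) ht x
    have e3 := auxW_comp hg (hwc (t + T)) h1c (a := t) (b := t + T) (c := 1) (by linarith)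
      (by
        intro s hs
        rw [one_mul]
        apply Real.exp_le_one_iff.mpr
        nlinarith [hs.2]) x
    have e4 := aux_expint hk0 t0 t (t + T)
    rw [add_sub_cancel_left] at e4
    have e5 : (∫ s in t0..t, Real.exp (-k0 * (t + T - s))) * D * (x ⬝ᵥ x) ≤ δ * (x ⬝ᵥ x) :=
      mul_le_mul_of_nonneg_right (mul_le_mul_of_nonneg_right e4 hD0.le) (aux_nonneg x)
    linarith
  · intro x
    have e2 := auxW_le hg h1c h1p hD (a := t) (b := t + T) (by linarith) x
    simpa using e2
  · intro l hl hl2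
    exact ⟨by linarith, hl2.trans (le_max_right _ _)⟩

/-- Corollary 2: a bounded continuous regressor `φ̄` is semi-persistently
exciting with rank `r` (the `r` largest eigenvalues of
`∫_t^{t+T} φ̄ φ̄ᵀ` lie in `[α_low, α_up]`, the others are zero, for all
`t ≥ t0`) iff, for the filtered extended regressor
`φ(t) = ∫_{t0}^t e^{−k0(t−s)} φ̄ φ̄ᵀ ds`, the `r` largest eigenvalues exceed
some `μ > 0` (the others being zero) for all `t ≥ t0 + kT`. -/
theorem corollary2_sPE_iff_filtered_lower_bound
    (n r : ℕ) (hr0 : 0 < r) (hrn : r < n) (t0 k0 : ℝ) (hk0 : 0 < k0)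
    (φbar : ℝ → Fin n → ℝ)
    (hc : ContinuousOn φbar (Set.Ici t0))
    (hb : ∃ Cb, ∀ t, t0 ≤ t → ‖φbar t‖ ≤ Cb)
    (φ : ℝ → Matrix (Fin n) (Fin n) ℝ)
    (hφ : ∀ t i j, φ t i j =
      ∫ s in t0..t, Real.exp (-k0 * (t - s)) * (φbar s i * φbar s j)) :
    (∃ T > (0 : ℝ), ∃ αlow αup : ℝ, 0 < αlow ∧ αlow ≤ αup ∧
        ∀ t, t0 ≤ t →
          EigProfile (Matrix.of fun i j =>
              ∫ τ in t..t + T, φbar τ i * φbar τ j) r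
            (fun x => αlow ≤ x ∧ x ≤ αup)) ↔
    (∃ T > (0 : ℝ), ∃ k : ℕ, 0 < k ∧ ∃ μ > (0 : ℝ),
        ∀ t, t0 + k * T ≤ t →
          EigProfile (φ t) r (fun x => μ < x)) := by
  obtain ⟨C, hC⟩ := hb
  let g : ℝ → Fin n → ℝ := fun t => φbar (max t t0)
  have hg : Continuous g :=
    hc.comp_continuous (continuous_id.max continuous_const) fun t => Set.mem_Ici.mpr (le_max_right _ _)
  have hgb : ∀ s i, (g s i) ^ 2 ≤ C ^ 2 := by
    intro s i
    have h1 := (norm_le_pi_norm (g s) i).trans (hC _ (le_max_right s t0))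
    rw [Real.norm_eq_abs] at h1
    exact sq_le_sq' (abs_le.mp h1).1 (abs_le.mp h1).2
  have hD0 : (0:ℝ) < n * C ^ 2 + 1 := by positivity
  have hD : ∀ s x, (g s ⬝ᵥ x) ^ 2 ≤ (n * C ^ 2 + 1) * (x ⬝ᵥ x) := by
    intro s x
    have h1 := Finset.sum_mul_sq_le_sq_mul_sq Finset.univ (g s) x
    have h2 : ∑ i, (g s i) ^ 2 ≤ n * C ^ 2 := by
      have := Finset.sum_le_sum (s := Finset.univ) fun i _ => hgb s i
      simpa using this
    have h3 : ∑ i, x i ^ 2 = x ⬝ᵥ x := by simp [dotProduct, pow_two]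
    rw [h3] at h1
    exact h1.trans (mul_le_mul_of_nonneg_right (by linarith) (aux_nonneg x))
  have hM : ∀ T > 0, ∀ t, t0 ≤ t → (Matrix.of fun i j => ∫ τ in t..t + T, φbar τ i * φbar τ j) =
      auxW g (fun _ => 1) t (t + T) := by
    intro T hT t ht
    ext i j
    simp only [auxW, Matrix.of_apply]
    apply intervalIntegral.integral_congr
    intro s hs
    rw [Set.uIcc_of_le (by linarith)] at hs
    simp [g, max_eq_left (ht.trans hs.1)]
  have hF : ∀ t, t0 ≤ t → φ t = auxW g (fun s => Real.exp (-k0 * (t - s))) t0 t := by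
    intro t ht
    ext i j
    rw [hφ]
    simp only [auxW, Matrix.of_apply]
    apply intervalIntegral.integral_congr
    intro s hs
    rw [Set.uIcc_of_le ht] at hs
    simp [g, max_eq_left hs.1]
  constructor
  · rintro ⟨T, hT, αlow, αup, hα, -, H⟩
    obtain ⟨μ, hμ, h⟩ := aux_forward hrn hk0 hg hD0 hD hT hα
      (fun t ht => (hM T hT t ht) ▸ H t ht)
    refine ⟨T, hT, 1, one_pos, μ, hμ, fun t ht => ?_⟩
    rw [Nat.cast_one, one_mul] at ht
    rw [hF t (by linarith)]
    exact h t ht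
  · rintro ⟨T, hT, k, hk, μ, hμ, H⟩
    have hk' : (0:ℝ) < k := by exact_mod_cast hk
    have hkT : 0 < k * T := by positivity
    obtain ⟨T', hT', a, b, ha, hab, h⟩ := aux_backward (t0 := t0) hrn hk0 hg hD0 hD hkT hμ
      (fun t ht => (hF t (by linarith)) ▸ H t ht)
    refine ⟨T', hT', a, b, ha, hab, fun t ht => ?_⟩
    rw [hM T' hT' t ht]
    exact h t ht
end
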